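/- Fix σ > 0 and c > 0. There exist K > 0 and an integer n₀ such that for all integers n ≥ n₀ and all integers k with 1 ≤ k ≤ n/c, the k-th positive zero κ_{n,k} of φ_{n,σ} satisfies |κ_{n,k} − F(n, k − 3/4)| ≤ K·n^{1/3}·k^{−4/3}. -/

import Mathlib

open Real MeasureTheory

/-- The Bessel function of integer order `n`: `J_n(x) = (1/π)∫₀^π cos(x sin t − n t) dt`. -/
noncomputable def besselJ (n : ℕ) (x : ℝ) : ℝ :=
  (1 / π) * ∫ t in (0:ℝ)..π, Real.cos (x * Real.sin t - n * t)

/-- The derivative `J_n′` of the Bessel function. -/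
noncomputable def besselJ' (n : ℕ) (x : ℝ) : ℝ := deriv (besselJ n) x

/-- `φ_{n,σ}(x) = x·J_n′(x) + σ·J_n(x)`. -/
noncomputable def phiRobin (σ : ℝ) (n : ℕ) (x : ℝ) : ℝ :=
  x * besselJ' n x + σ * besselJ n x

/-- `g(x) = (1/π)(√(1−x²) − x·arccos x)`. -/
noncomputable def gfun (x : ℝ) : ℝ :=
  (1 / π) * (Real.sqrt (1 - x ^ 2) - x * Real.arccos x)

open Filter Topology

lemma dint {E : Type*} [NormedAddCommGroup E] [NormedSpace ℝ E]
    (f f' : ℝ → ℝ → E) (a b : ℝ)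
    (hf : Continuous (fun p : ℝ × ℝ => f p.1 p.2)) (hf' : Continuous (fun p : ℝ × ℝ => f' p.1 p.2))
    (hd : ∀ x t, HasDerivAt (fun x => f x t) (f' x t) x) (x : ℝ) :
    HasDerivAt (fun x => ∫ t in a..b, f x t) (∫ t in a..b, f' x t) x := by
  have hc : ∀ x, Continuous (f x) := fun x => hf.comp (by fun_prop : Continuous fun t : ℝ => (x, t))
  have hc' : ∀ x, Continuous (f' x) :=
    fun x => hf'.comp (by fun_prop : Continuous fun t : ℝ => (x, t))
  obtain ⟨C, hC⟩ := ((isCompact_closedBall x 1).prod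
    (isCompact_uIcc (a := a) (b := b))).exists_bound_of_continuousOn hf'.continuousOn
  refine (intervalIntegral.hasDerivAt_integral_of_dominated_loc_of_deriv_le (bound := fun _ => C)
    (Metric.closedBall_mem_nhds x one_pos)
    (Eventually.of_forall fun x => (hc x).aestronglyMeasurable) ((hc x).intervalIntegrable _ _)
    (hc' x).aestronglyMeasurable ?_ (by simp) ?_).2
  · exact Eventually.of_forall fun t ht y hy => hC (y, t) ⟨hy, Set.uIoc_subset_uIcc ht⟩
  · exact Eventually.of_forall fun t ht y hy => hd y t

noncomputable def bJ1 (n : ℕ) (x : ℝ) : ℝ :=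
  (1 / π) * ∫ t in (0:ℝ)..π, -(Real.sin (x * Real.sin t - n * t) * Real.sin t)

noncomputable def bJ2 (n : ℕ) (x : ℝ) : ℝ :=
  (1 / π) * ∫ t in (0:ℝ)..π, -(Real.cos (x * Real.sin t - n * t) * Real.sin t * Real.sin t)

lemma hasDerivAt_bJ (n : ℕ) (x : ℝ) : HasDerivAt (besselJ n) (bJ1 n x) x := by
  refine HasDerivAt.const_mul (1 / π) (dint (fun x t => Real.cos (x * Real.sin t - n * t))
    (fun x t => -(Real.sin (x * Real.sin t - n * t) * Real.sin t)) _ _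
    (by fun_prop) (by fun_prop) ?_ x)
  intro x t
  have := (((hasDerivAt_id x).mul_const (Real.sin t)).sub_const ((n:ℝ) * t)).cos
  simpa using this

lemma hasDerivAt_bJ1 (n : ℕ) (x : ℝ) : HasDerivAt (bJ1 n) (bJ2 n x) x := by
  refine HasDerivAt.const_mul (1 / π) (dint
    (fun x t => -(Real.sin (x * Real.sin t - n * t) * Real.sin t))
    (fun x t => -(Real.cos (x * Real.sin t - n * t) * Real.sin t * Real.sin t)) _ _
    (by fun_prop) (by fun_prop) ?_ x)
  intro x t
  have := (((((hasDerivAt_id x).mul_const (Real.sin t)).sub_const ((n:ℝ) * t)).sin).mul_const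
    (Real.sin t)).neg
  simpa [Pi.neg_def] using this

lemma bessel_ode (n : ℕ) (x : ℝ) :
    x ^ 2 * bJ2 n x + x * bJ1 n x + (x ^ 2 - n ^ 2) * besselJ n x = 0 := by
  have h : ∫ t in (0:ℝ)..π, (-x * Real.sin t * Real.sin (x * Real.sin t - n * t) +
      (x * Real.cos t + n) * (Real.cos (x * Real.sin t - n * t) * (x * Real.cos t - n))) = 0 := by
    rw [intervalIntegral.integral_eq_sub_of_hasDerivAt
      (f := fun t => (x * Real.cos t + n) * Real.sin (x * Real.sin t - n * t))]
    · simp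
    · intro t _
      have h1 : HasDerivAt (fun t => x * Real.cos t + n) (-x * Real.sin t) t := by
        simpa using ((Real.hasDerivAt_cos t).const_mul x).add_const (n:ℝ)
      have h2 : HasDerivAt (fun t => x * Real.sin t - n * t) (x * Real.cos t - n) t := by
        simpa [Pi.sub_def] using ((Real.hasDerivAt_sin t).const_mul x).sub ((hasDerivAt_id t).const_mul (n:ℝ))
      exact h1.mul h2.sin
    · apply Continuous.intervalIntegrable; fun_prop
  unfold bJ2 bJ1 besselJ
  have key : ∫ t in (0:ℝ)..π, (-x * Real.sin t * Real.sin (x * Real.sin t - n * t) +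
      (x * Real.cos t + n) * (Real.cos (x * Real.sin t - n * t) * (x * Real.cos t - n))) =
      x ^ 2 * (∫ t in (0:ℝ)..π, -(Real.cos (x * Real.sin t - n * t) * Real.sin t * Real.sin t)) +
      x * (∫ t in (0:ℝ)..π, -(Real.sin (x * Real.sin t - n * t) * Real.sin t)) +
      (x ^ 2 - n ^ 2) * ∫ t in (0:ℝ)..π, Real.cos (x * Real.sin t - n * t) := by
    rw [← intervalIntegral.integral_const_mul, ← intervalIntegral.integral_const_mul,
      ← intervalIntegral.integral_const_mul, ← intervalIntegral.integral_add,
      ← intervalIntegral.integral_add]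
    · congr 1; ext t
      have := Real.sin_sq_add_cos_sq t
      linear_combination (x ^ 2 * Real.cos (x * Real.sin t - n * t)) * this
    all_goals apply Continuous.intervalIntegrable; fun_prop
  linear_combination (1/π) * (h - key)

noncomputable def bZ (n : ℕ) (x : ℝ) : ℝ := x * bJ1 n x

lemma hasDerivAt_bZ (n : ℕ) (x : ℝ) (hx : 0 < x) :
    HasDerivAt (bZ n) (-(x ^ 2 - n ^ 2) / x * besselJ n x) x := by
  have e := bessel_ode n x
  refine ((hasDerivAt_id x).mul (hasDerivAt_bJ1 n x)).congr_deriv ?_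
  simp only [id]
  field_simp
  linear_combination e

lemma hasDerivAt_bJz (n : ℕ) (x : ℝ) (hx : 0 < x) :
    HasDerivAt (besselJ n) (bZ n x / x) x := by
  have := hasDerivAt_bJ n x
  convert this using 1
  unfold bZ; field_simp

lemma phi_eq (σ : ℝ) (n : ℕ) (x : ℝ) : phiRobin σ n x = bZ n x + σ * besselJ n x := by
  unfold phiRobin besselJ' bZ
  rw [(hasDerivAt_bJ n x).deriv]

lemma bJ_zero (n : ℕ) (hn : 1 ≤ n) : besselJ n 0 = 0 := by
  have hn' : (n:ℝ) ≠ 0 := by positivity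
  unfold besselJ
  have h : ∫ t in (0:ℝ)..π, Real.cos (n * t) = 0 := by
    rw [intervalIntegral.integral_eq_sub_of_hasDerivAt
      (f := fun t => Real.sin (n * t) / n)]
    · simp
    · intro t _
      refine ((((hasDerivAt_id t).const_mul (n:ℝ)).sin).div_const (n:ℝ)).congr_deriv ?_
      simp only [id]
      field_simp
    · apply Continuous.intervalIntegrable; fun_prop
  simp [h]

lemma norm_cexp_phase (x a : ℝ) : ‖Complex.exp (-(Complex.I * ((x * a : ℝ) : ℂ)))‖ = 1 := by
  have : -(Complex.I * ((x * a : ℝ) : ℂ)) = ((-(x * a) : ℝ) : ℂ) * Complex.I := by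
    push_cast; ring
  rw [this, Complex.norm_exp_ofReal_mul_I]

lemma osc (a b : ℝ) (hab : a ≤ b) (ϑ ϑ' q q' : ℝ → ℝ)
    (hϑ : ∀ u, HasDerivAt ϑ (ϑ' u) u) (hϑ' : Continuous ϑ')
    (hq : ∀ u ∈ Set.Icc a b, HasDerivAt q (q' u) u) (hq' : ContinuousOn q' (Set.Icc a b)) :
    ∃ C, ∀ x : ℝ, 0 < x →
      ‖∫ u in a..b, Complex.exp (-(Complex.I * ((x * ϑ u : ℝ) : ℂ))) * ((ϑ' u * q u : ℝ) : ℂ)‖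
        ≤ C / x := by
  refine ⟨|q b| + |q a| + ∫ u in a..b, |q' u|, fun x hx => ?_⟩
  have hxI : Complex.I * (x:ℂ) ≠ 0 := mul_ne_zero Complex.I_ne_zero (by exact_mod_cast hx.ne')
  set v : ℝ → ℂ := fun u => Complex.exp (-(Complex.I * ((x * ϑ u : ℝ) : ℂ))) / (-(Complex.I * x))
    with hv
  have hvn : ∀ u, ‖v u‖ = 1 / x := by
    intro u
    simp only [hv, norm_div, norm_cexp_phase, norm_neg, norm_mul, Complex.norm_I, one_mul,
      Complex.norm_real, Real.norm_eq_abs, abs_of_pos hx]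
  have hvd : ∀ u, HasDerivAt v
      (Complex.exp (-(Complex.I * ((x * ϑ u : ℝ) : ℂ))) * (ϑ' u : ℂ)) u := by
    intro u
    have h1 : HasDerivAt (fun u => ((x * ϑ u : ℝ) : ℂ)) ((x * ϑ' u : ℝ) : ℂ) u :=
      ((hϑ u).const_mul x).ofReal_comp
    refine (((h1.const_mul Complex.I).neg).cexp.div_const (-(Complex.I * x))).congr_deriv ?_
    rw [div_eq_iff (neg_ne_zero.2 hxI)]
    simp only [Pi.neg_apply]
    push_cast
    ring
  have hcϑ : Continuous ϑ := continuous_iff_continuousAt.2 fun u => (hϑ u).continuousAt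
  have hvc : Continuous v := by
    simp only [hv]
    fun_prop
  have hparts := intervalIntegral.integral_mul_deriv_eq_deriv_mul (a := a) (b := b)
    (u := fun u => (q u : ℂ)) (u' := fun u => (q' u : ℂ)) (v := v)
    (v' := fun u => Complex.exp (-(Complex.I * ((x * ϑ u : ℝ) : ℂ))) * (ϑ' u : ℂ))
    (fun u hu => (hq u (by rwa [Set.uIcc_of_le hab] at hu)).ofReal_comp)
    (fun u _ => hvd u)
    (by
      apply ContinuousOn.intervalIntegrable
      rw [Set.uIcc_of_le hab]
      exact Complex.continuous_ofReal.comp_continuousOn hq')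
    (by apply Continuous.intervalIntegrable; fun_prop)
  have e : (∫ u in a..b, Complex.exp (-(Complex.I * ((x * ϑ u : ℝ) : ℂ))) * ((ϑ' u * q u : ℝ) : ℂ))
      = ∫ u in a..b, (q u : ℂ) *
        (Complex.exp (-(Complex.I * ((x * ϑ u : ℝ) : ℂ))) * (ϑ' u : ℂ)) := by
    congr 1; ext u; push_cast; ring
  rw [e, hparts]
  have hint : ‖∫ u in a..b, (q' u : ℂ) * v u‖ ≤ (∫ u in a..b, |q' u|) / x := by
    rw [← intervalIntegral.integral_div]
    refine intervalIntegral.norm_integral_le_of_norm_le hab ?_ ?_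
    · refine Eventually.of_forall fun u _ => ?_
      rw [norm_mul, hvn, Complex.norm_real, Real.norm_eq_abs]
      exact le_of_eq (by ring)
    · apply ContinuousOn.intervalIntegrable
      rw [Set.uIcc_of_le hab]
      exact (hq'.abs).div_const x
  calc _ ≤ ‖(q b : ℂ) * v b - (q a : ℂ) * v a‖ + ‖∫ u in a..b, (q' u : ℂ) * v u‖ := norm_sub_le _ _
    _ ≤ ‖(q b : ℂ) * v b‖ + ‖(q a : ℂ) * v a‖ + ‖∫ u in a..b, (q' u : ℂ) * v u‖ := by
        gcongr; exact norm_sub_le _ _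
    _ ≤ |q b| * (1/x) + |q a| * (1/x) + (∫ u in a..b, |q' u|) / x := by
        gcongr
        · rw [norm_mul, hvn, Complex.norm_real, Real.norm_eq_abs]
        · rw [norm_mul, hvn, Complex.norm_real, Real.norm_eq_abs]
    _ = _ := by ring

noncomputable def fS (x : ℝ) : ℂ := ∫ s in (0:ℝ)..1, Complex.exp (-(Complex.I * ((x * s ^ 2 : ℝ) : ℂ)))
noncomputable def fA (T : ℝ) : ℂ := ∫ s in (0:ℝ)..T, Complex.exp (-(Complex.I * ((1 * s ^ 2 : ℝ) : ℂ)))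
noncomputable def fG (T : ℝ) : ℂ :=
  ∫ t in (0:ℝ)..1, Complex.exp (-(Complex.I * ((T ^ 2 * (1 + t ^ 2) : ℝ) : ℂ))) *
    (((1 + t ^ 2)⁻¹ : ℝ) : ℂ)

lemma fA_eq (T : ℝ) : fA T = T * fS (T ^ 2) := by
  unfold fA fS
  have := intervalIntegral.smul_integral_comp_mul_left (a := 0) (b := 1) (c := T)
    (f := fun s : ℝ => Complex.exp (-(Complex.I * ((1 * s ^ 2 : ℝ) : ℂ))))
  rw [mul_zero, mul_one] at this
  rw [← this, Complex.real_smul]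
  congr 2; ext s
  congr 1; push_cast; ring

lemma fA_deriv (T : ℝ) : HasDerivAt fA (Complex.exp (-(Complex.I * ((1 * T ^ 2 : ℝ) : ℂ)))) T := by
  have hc : Continuous fun s : ℝ => Complex.exp (-(Complex.I * ((1 * s ^ 2 : ℝ) : ℂ))) := by fun_prop
  exact intervalIntegral.integral_hasDerivAt_right (hc.intervalIntegrable _ _)
    (hc.stronglyMeasurableAtFilter _ _) hc.continuousAt

lemma fG_deriv (T : ℝ) : HasDerivAt fG (∫ t in (0:ℝ)..1, 
    Complex.exp (-(Complex.I * ((T ^ 2 * (1 + t ^ 2) : ℝ) : ℂ))) * (-(Complex.I * (2 * T)))) T := by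
  have hc : ∀ t : ℝ, 1 + t ^ 2 ≠ 0 := fun t => by positivity
  have hc2 : Continuous fun t : ℝ => (1 + t ^ 2)⁻¹ :=
    Continuous.inv₀ (by fun_prop) hc
  refine dint (fun T t => Complex.exp (-(Complex.I * ((T ^ 2 * (1 + t ^ 2) : ℝ) : ℂ))) *
    (((1 + t ^ 2)⁻¹ : ℝ) : ℂ)) (fun T t =>
    Complex.exp (-(Complex.I * ((T ^ 2 * (1 + t ^ 2) : ℝ) : ℂ))) * (-(Complex.I * (2 * T)))) 0 1 
    ?_ (by fun_prop) ?_ T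
  · have : Continuous fun p : ℝ × ℝ => (((1 + p.2 ^ 2)⁻¹ : ℝ) : ℂ) :=
      Complex.continuous_ofReal.comp (hc2.comp continuous_snd)
    fun_prop
  · intro T t
    have h1 : HasDerivAt (fun T => ((T ^ 2 * (1 + t ^ 2) : ℝ) : ℂ))
        ((2 * T * (1 + t ^ 2) : ℝ) : ℂ) T := by
      have := (((hasDerivAt_pow 2 T).mul_const (1 + t ^ 2)).ofReal_comp)
      simpa using this
    refine ((((h1.const_mul Complex.I).neg).cexp).mul_const (((1 + t ^ 2)⁻¹ : ℝ) : ℂ)).congr_deriv ?_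
    have : (1 + (t:ℂ) ^ 2) ≠ 0 := by exact_mod_cast hc t
    simp only [Pi.neg_apply]
    push_cast
    field_simp

lemma fA_sq (T : ℝ) : fA T ^ 2 = Complex.I * fG T - Complex.I * (π / 4) := by
  have hd : ∀ T, HasDerivAt (fun T => fA T ^ 2 - Complex.I * fG T) 0 T := by
    intro T
    refine (((fA_deriv T).pow 2).sub ((fG_deriv T).const_mul Complex.I)).congr_deriv ?_
    have h2 : (∫ t in (0:ℝ)..1, Complex.exp (-(Complex.I * ((T ^ 2 * (1 + t ^ 2) : ℝ) : ℂ))) *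
        (-(Complex.I * (2 * T)))) = 
        Complex.exp (-(Complex.I * ((1 * T ^ 2 : ℝ) : ℂ))) * (-(Complex.I * (2 * T))) * fS (T ^ 2) := by
      unfold fS
      rw [← intervalIntegral.integral_const_mul]
      congr 1; ext t
      rw [mul_right_comm, ← Complex.exp_add]
      congr 2
      push_cast; ring
    rw [h2, fA_eq]
    push_cast
    linear_combination (2 * Complex.exp (-(Complex.I * (1 * (T:ℂ) ^ 2))) * T * fS (T ^ 2)) * Complex.I_sq
  have hconst := is_const_of_deriv_eq_zero (fun T => (hd T).differentiableAt) (fun T => (hd T).deriv) T 0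
  have hA0 : fA 0 = 0 := by simp [fA]
  have hG0 : fG 0 = π / 4 := by
    have : fG 0 = ∫ t in (0:ℝ)..1, (((1 + t ^ 2)⁻¹ : ℝ) : ℂ) := by
      unfold fG; congr 1; ext t; simp
    rw [this, intervalIntegral.integral_ofReal, integral_inv_one_add_sq]
    simp
  simp only [hA0, hG0] at hconst
  linear_combination hconst

lemma fG_eq (T : ℝ) : fG T = Complex.exp (-(Complex.I * ((1 * T ^ 2 : ℝ) : ℂ))) *
    (fS (T ^ 2) - ∫ t in (0:ℝ)..1, Complex.exp (-(Complex.I * ((T ^ 2 * t ^ 2 : ℝ) : ℂ))) *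
      ((2 * t * (t / (2 * (1 + t ^ 2))) : ℝ) : ℂ)) := by
  have hc : ∀ t : ℝ, 1 + t ^ 2 ≠ 0 := fun t => by positivity
  have hc2 : Continuous fun t : ℝ => (2 * t * (t / (2 * (1 + t ^ 2))) : ℝ) :=
    Continuous.mul (by fun_prop) (Continuous.div (by fun_prop) (by fun_prop) (fun t => by positivity))
  unfold fS fG
  rw [← intervalIntegral.integral_sub, ← intervalIntegral.integral_const_mul]
  · congr 1; ext t
    rw [show -(Complex.I * ((T ^ 2 * (1 + t ^ 2) : ℝ) : ℂ)) = -(Complex.I * ((1 * T ^ 2 : ℝ) : ℂ)) +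
      -(Complex.I * ((T ^ 2 * t ^ 2 : ℝ) : ℂ)) by push_cast; ring, Complex.exp_add]
    have : (1 + (t:ℂ) ^ 2) ≠ 0 := by exact_mod_cast hc t
    push_cast
    field_simp
    ring
  · apply Continuous.intervalIntegrable; fun_prop
  · apply Continuous.intervalIntegrable; fun_prop

lemma fG_norm_le (T : ℝ) : ‖fG T‖ ≤ 1 := by
  unfold fG
  have := intervalIntegral.norm_integral_le_of_norm_le_const (a := 0) (b := 1) (C := 1)
    (f := fun t : ℝ => Complex.exp (-(Complex.I * ((T ^ 2 * (1 + t ^ 2) : ℝ) : ℂ))) *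
    (((1 + t ^ 2)⁻¹ : ℝ) : ℂ)) ?_
  · simpa using this
  · intro t _
    rw [norm_mul, norm_cexp_phase, one_mul, Complex.norm_real, Real.norm_eq_abs, abs_of_pos (by positivity)]
    exact inv_le_one_of_one_le₀ (by nlinarith [sq_nonneg t])

lemma fS_tendsto : Tendsto (fun x : ℝ => (x : ℂ) * fS x ^ 2) atTop (𝓝 (-(Complex.I * (π / 4)))) := by
  obtain ⟨C, hC⟩ := osc 0 1 zero_le_one (fun t => t ^ 2) (fun t => 2 * t)
    (fun t => t / (2 * (1 + t ^ 2)))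
    (fun t => (1 * (2 * (1 + t ^ 2)) - t * (2 * (2 * t))) / (2 * (1 + t ^ 2)) ^ 2)
    (fun u => by simpa using hasDerivAt_pow 2 u) (by fun_prop)
    (fun u _ => by
      have h1 : HasDerivAt (fun t : ℝ => 2 * (1 + t ^ 2)) (2 * (2 * u)) u := by
        simpa using (((hasDerivAt_pow 2 u).const_add 1).const_mul 2)
      exact (hasDerivAt_id u).div h1 (by positivity))
    (Continuous.continuousOn (Continuous.div (by fun_prop) (by fun_prop) (fun t => by positivity)))
  have hG : Tendsto (fun x : ℝ => fG (√x)) atTop (𝓝 0) := by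
    have hb : ∀ᶠ x : ℝ in atTop, ‖fG (√x)‖ ≤ 2 / √x + C / x := by
      filter_upwards [eventually_gt_atTop 0] with x hx
      have hsx : (√x) ^ 2 = x := Real.sq_sqrt hx.le
      have hs := Real.sqrt_pos.2 hx
      rw [fG_eq, norm_mul, norm_cexp_phase, one_mul, hsx]
      refine (norm_sub_le _ _).trans (add_le_add ?_ (hC x hx))
      have h1 := fA_sq (√x)
      have h2 : ‖fA (√x)‖ ^ 2 ≤ 2 ^ 2 := by
        rw [← norm_pow, h1]
        refine (norm_sub_le _ _).trans ?_
        have h3 : ‖Complex.I * (π / 4 : ℂ)‖ = π / 4 := by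
          rw [norm_mul, Complex.norm_I, one_mul]
          rw [show (π / 4 : ℂ) = ((π / 4 : ℝ) : ℂ) by push_cast; ring, Complex.norm_real,
            Real.norm_eq_abs, abs_of_pos (by positivity)]
        rw [h3, norm_mul, Complex.norm_I, one_mul]
        have := fG_norm_le (√x)
        have := Real.pi_le_four
        linarith
      have h4 := (abs_le_of_sq_le_sq' h2 (by norm_num)).2
      rw [fA_eq, hsx, norm_mul, Complex.norm_real, Real.norm_eq_abs, abs_of_pos hs] at h4
      rw [le_div_iff₀ hs]; linarith
    refine squeeze_zero_norm' hb ?_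
    have t1 : Tendsto (fun x : ℝ => 2 / √x) atTop (𝓝 0) :=
      tendsto_const_nhds.div_atTop Real.tendsto_sqrt_atTop
    have t2 : Tendsto (fun x : ℝ => C / x) atTop (𝓝 0) :=
      tendsto_const_nhds.div_atTop tendsto_id
    simpa using t1.add t2
  have h5 : Tendsto (fun x : ℝ => Complex.I * fG (√x) - Complex.I * (π / 4)) atTop
      (𝓝 (Complex.I * 0 - Complex.I * (π / 4))) := (hG.const_mul _).sub_const _
  rw [mul_zero, zero_sub] at h5
  refine h5.congr' ?_
  filter_upwards [eventually_gt_atTop 0] with x hx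
  rw [← fA_sq, fA_eq, Real.sq_sqrt hx.le, mul_pow]
  congr 1
  exact_mod_cast Real.sq_sqrt hx.le

noncomputable def fI (w : ℝ → ℝ) (x : ℝ) : ℂ :=
  ∫ u in (0:ℝ)..(π/2), Complex.exp (-(Complex.I * ((x * (1 - Real.cos u) : ℝ) : ℂ))) * ((w u : ℝ) : ℂ)

lemma fI_half (x : ℝ) : fI (fun u => Real.cos (u / 2)) x = √2 * fS x := by
  have h := intervalIntegral.integral_deriv_smul_comp (a := 0) (b := π / 2)
    (f := fun u => √2 * Real.sin (u / 2)) (f' := fun u => √2 * (Real.cos (u / 2) / 2))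
    (g := fun s : ℝ => Complex.exp (-(Complex.I * ((x * s ^ 2 : ℝ) : ℂ)))) ?_ ?_ ?_
  · have e1 : √2 * Real.sin (π / 2 / 2) = 1 := by
      rw [show π / 2 / 2 = π / 4 by ring, Real.sin_pi_div_four]
      have := Real.mul_self_sqrt (show (0:ℝ) ≤ 2 by norm_num)
      linarith
    simp only [e1, zero_div, Real.sin_zero, mul_zero] at h
    unfold fS fI
    rw [← h, ← intervalIntegral.integral_const_mul]
    congr 1; ext u
    have h2 : (√2 * Real.sin (u / 2)) ^ 2 = 1 - Real.cos u := by
      rw [mul_pow, Real.sq_sqrt (by norm_num), show Real.cos u = Real.cos (2 * (u / 2)) by ring_nf,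
        Real.cos_two_mul]
      linarith [Real.sin_sq_add_cos_sq (u / 2)]
    have h3 : ((√2 : ℝ) : ℂ) ^ 2 = 2 := by exact_mod_cast Real.sq_sqrt (show (0:ℝ) ≤ 2 by norm_num)
    simp only [Function.comp, h2, Complex.real_smul, Complex.ofReal_mul, Complex.ofReal_div, Complex.ofReal_ofNat]
    linear_combination (-(Complex.exp (-(Complex.I * ((x:ℂ) * ((1 - Real.cos u : ℝ):ℂ)))) * (Real.cos (u/2) / 2))) * h3
  · intro u _
    have := (((hasDerivAt_id u).div_const 2).sin).const_mul (√2)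
    refine this.congr_deriv ?_
    simp only [id]; ring
  · fun_prop
  · fun_prop

def fClose (w₁ w₂ : ℝ → ℝ) : Prop := ∃ C, ∀ x : ℝ, 0 < x → ‖fI w₁ x - fI w₂ x‖ ≤ C / x

lemma fClose.trans {a b c : ℝ → ℝ} (h1 : fClose a b) (h2 : fClose b c) : fClose a c := by
  obtain ⟨C, hC⟩ := h1
  obtain ⟨D, hD⟩ := h2
  refine ⟨C + D, fun x hx => ?_⟩
  have := norm_add_le (fI a x - fI b x) (fI b x - fI c x)
  rw [sub_add_sub_cancel] at this
  have := hC x hx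
  have := hD x hx
  rw [add_div]; linarith

lemma fClose_of (w₁ w₂ q q' : ℝ → ℝ) (h1 : Continuous w₁) (h2 : Continuous w₂)
    (hq : ∀ u ∈ Set.Icc 0 (π/2), HasDerivAt q (q' u) u) (hq' : ContinuousOn q' (Set.Icc 0 (π/2)))
    (h : ∀ u ∈ Set.Icc 0 (π/2), w₁ u - w₂ u = Real.sin u * q u) : fClose w₁ w₂ := by
  obtain ⟨C, hC⟩ := osc 0 (π/2) (by positivity) (fun u => 1 - Real.cos u) Real.sin q q'
    (fun u => by simpa using (Real.hasDerivAt_cos u).const_sub 1) Real.continuous_sin hq hq'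
  refine ⟨C, fun x hx => ?_⟩
  convert hC x hx using 2
  unfold fI
  rw [← intervalIntegral.integral_sub]
  · apply intervalIntegral.integral_congr
    intro u hu
    rw [Set.uIcc_of_le (by positivity)] at hu
    simp only
    rw [← h u hu]
    push_cast; ring
  · apply Continuous.intervalIntegrable; fun_prop
  · apply Continuous.intervalIntegrable; fun_prop

lemma cos_pos_aux (u : ℝ) (hu : u ∈ Set.Icc 0 (π/2)) : 0 < Real.cos (u / 2) ∧ 0 < Real.cos (u / 4) := by
  have := Real.pi_pos
  constructor <;> apply Real.cos_pos_of_mem_Ioo <;> constructor <;> linarith [hu.1, hu.2]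

lemma fClose0 : fClose (fun u => Real.cos ((0:ℕ) * u)) (fun u => Real.cos (u / 2)) := by
  refine fClose_of _ _ (fun u => Real.sin (u / 4) / (2 * Real.cos (u / 4) * Real.cos (u / 2)))
    (fun u => (Real.cos (u / 4) * (1 / 4) * (2 * Real.cos (u / 4) * Real.cos (u / 2)) -
      Real.sin (u / 4) * (2 * (-Real.sin (u / 4) * (1 / 4)) * Real.cos (u / 2) +
        2 * Real.cos (u / 4) * (-Real.sin (u / 2) * (1 / 2)))) /
        (2 * Real.cos (u / 4) * Real.cos (u / 2)) ^ 2)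
    (by fun_prop) (by fun_prop) ?_ ?_ ?_
  · intro u hu
    obtain ⟨h1, h2⟩ := cos_pos_aux u hu
    refine HasDerivAt.div ?_ ?_ (by positivity)
    · exact ((hasDerivAt_id u).div_const 4).sin
    · exact ((((hasDerivAt_id u).div_const 4).cos).const_mul 2).mul (((hasDerivAt_id u).div_const 2).cos)
  · refine ContinuousOn.div (by fun_prop) (by fun_prop) ?_
    intro u hu
    obtain ⟨h1, h2⟩ := cos_pos_aux u hu
    positivity
  · intro u hu
    obtain ⟨h1, h2⟩ := cos_pos_aux u hu
    have e1 : Real.sin u = 2 * (2 * Real.sin (u / 4) * Real.cos (u / 4)) * Real.cos (u / 2) := by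
      rw [← Real.sin_two_mul, show 2 * (u / 4) = u / 2 by ring, ← Real.sin_two_mul,
        show 2 * (u / 2) = u by ring]
    have e2 : Real.cos (u / 2) = 2 * Real.cos (u / 4) ^ 2 - 1 := by
      rw [← Real.cos_two_mul, show 2 * (u / 4) = u / 2 by ring]
    have e3 := Real.sin_sq_add_cos_sq (u / 4)
    rw [e1]
    field_simp
    simp only [Nat.cast_zero, zero_mul, Real.cos_zero]
    rw [e2]
    linarith

lemma fClose1 : fClose (fun u => Real.cos ((1:ℕ) * u)) (fun u => Real.cos ((0:ℕ) * u)) := by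
  refine fClose_of _ _ (fun u => -Real.sin (u / 2) / Real.cos (u / 2))
    (fun u => (-(Real.cos (u / 2) * (1 / 2)) * Real.cos (u / 2) -
      (-Real.sin (u / 2)) * (-Real.sin (u / 2) * (1 / 2))) / Real.cos (u / 2) ^ 2)
    (by fun_prop) (by fun_prop) ?_ ?_ ?_
  · intro u hu
    obtain ⟨h1, h2⟩ := cos_pos_aux u hu
    refine HasDerivAt.div ?_ ?_ h1.ne'
    · exact ((hasDerivAt_id u).div_const 2).sin.neg
    · exact ((hasDerivAt_id u).div_const 2).cos
  · refine ContinuousOn.div (by fun_prop) (by fun_prop) ?_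
    intro u hu
    obtain ⟨h1, h2⟩ := cos_pos_aux u hu
    positivity
  · intro u hu
    obtain ⟨h1, h2⟩ := cos_pos_aux u hu
    have e1 : Real.sin u = 2 * Real.sin (u / 2) * Real.cos (u / 2) := by
      rw [← Real.sin_two_mul, show 2 * (u / 2) = u by ring]
    have e2 : Real.cos u = 2 * Real.cos (u / 2) ^ 2 - 1 := by
      rw [← Real.cos_two_mul, show 2 * (u / 2) = u by ring]
    have e3 := Real.sin_sq_add_cos_sq (u / 2)
    simp only [Nat.cast_zero, zero_mul, Real.cos_zero, Nat.cast_one, one_mul]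
    rw [e1, e2]
    field_simp
    linarith

lemma fClose_step (n : ℕ) :
    fClose (fun u => Real.cos ((n + 2 : ℕ) * u)) (fun u => Real.cos ((n:ℕ) * u)) := by
  refine fClose_of _ _ (fun u => -2 * Real.sin ((n + 1) * u))
    (fun u => -2 * (Real.cos ((n + 1) * u) * ((n + 1) * 1)))
    (by fun_prop) (by fun_prop) ?_ (by fun_prop) ?_
  · intro u _
    exact (((hasDerivAt_id u).const_mul ((n:ℝ) + 1)).sin).const_mul (-2)
  · intro u _
    rw [Real.cos_sub_cos]
    push_cast
    rw [show (((n:ℝ) + 2) * u + n * u) / 2 = (n + 1) * u by ring,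
      show (((n:ℝ) + 2) * u - n * u) / 2 = u by ring]
    ring

lemma fClose_all (n : ℕ) : fClose (fun u => Real.cos ((n:ℕ) * u)) (fun u => Real.cos (u / 2)) := by
  have h : ∀ n : ℕ, fClose (fun u => Real.cos ((n:ℕ) * u)) (fun u => Real.cos (u / 2)) ∧
      fClose (fun u => Real.cos ((n + 1:ℕ) * u)) (fun u => Real.cos (u / 2)) := by
    intro n
    induction n with
    | zero => exact ⟨fClose0, fClose1.trans fClose0⟩
    | succ k ih => exact ⟨ih.2, (fClose_step k).trans ih.1⟩
  exact (h n).1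

lemma bJ_repr (n : ℕ) (x : ℝ) : besselJ n x = (2 / π) *
    (Complex.exp (Complex.I * ((x - n * (π / 2) : ℝ) : ℂ)) * fI (fun u => Real.cos ((n:ℕ) * u)) x).re := by
  have h1 : ∫ t in (0:ℝ)..π, Real.cos (x * Real.sin t - n * t) =
      ∫ u in (-(π/2))..(π/2), Real.cos (x * Real.cos u - n * (π/2) - n * u) := by
    have := intervalIntegral.integral_comp_add_right (a := -(π/2)) (b := π/2)
      (f := fun t => Real.cos (x * Real.sin t - n * t)) (π/2)
    rw [show -(π/2) + π/2 = 0 by ring, show π/2 + π/2 = π by ring] at this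
    rw [← this]
    congr 1; ext u
    rw [Real.sin_add_pi_div_two]
    congr 1; ring
  have hc : Continuous fun u : ℝ => Real.cos (x * Real.cos u - n * (π/2) - n * u) := by fun_prop
  have h2 : ∫ u in (-(π/2))..(0:ℝ), Real.cos (x * Real.cos u - n * (π/2) - n * u) =
      ∫ u in (0:ℝ)..(π/2), Real.cos (x * Real.cos u - n * (π/2) + n * u) := by
    have := intervalIntegral.integral_comp_neg (a := 0) (b := π/2)
      (f := fun u => Real.cos (x * Real.cos u - n * (π/2) - n * u))
    rw [neg_zero] at this
    rw [← this]
    congr 1; ext u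
    rw [Real.cos_neg]
    congr 1; ring
  have h3 : (Complex.exp (Complex.I * ((x - n * (π / 2) : ℝ) : ℂ)) *
      fI (fun u => Real.cos ((n:ℕ) * u)) x).re =
      ∫ u in (0:ℝ)..(π/2), Real.cos (x * Real.cos u - n * (π/2)) * Real.cos (n * u) := by
    unfold fI
    rw [← intervalIntegral.integral_const_mul]
    have := Complex.reCLM.intervalIntegral_comp_comm (μ := volume) (a := 0) (b := π/2)
      (f := fun u : ℝ => Complex.exp (Complex.I * ((x - n * (π / 2) : ℝ) : ℂ)) *
        (Complex.exp (-(Complex.I * ((x * (1 - Real.cos u) : ℝ) : ℂ))) *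
          ((Real.cos ((n:ℕ) * u) : ℝ) : ℂ))) (by
        apply Continuous.intervalIntegrable; fun_prop)
    simp only [Complex.reCLM_apply] at this
    rw [← this]
    congr 1; ext u
    rw [← mul_assoc, ← Complex.exp_add, Complex.re_mul_ofReal]
    rw [show Complex.I * ((x - n * (π / 2) : ℝ) : ℂ) + -(Complex.I * ((x * (1 - Real.cos u) : ℝ) : ℂ))
      = ((x * Real.cos u - n * (π/2) : ℝ) : ℂ) * Complex.I by push_cast; ring,
      Complex.exp_ofReal_mul_I_re]
  rw [h3]
  unfold besselJ
  rw [h1, ← intervalIntegral.integral_add_adjacent_intervals (hc.intervalIntegrable _ _)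
    (hc.intervalIntegrable _ _) (b := 0), h2, ← intervalIntegral.integral_add]
  · have : (fun u => Real.cos (x * Real.cos u - n * (π/2) + n * u) +
        Real.cos (x * Real.cos u - n * (π/2) - n * u)) =
        fun u => 2 * (Real.cos (x * Real.cos u - n * (π/2)) * Real.cos (n * u)) := by
      ext u
      rw [Real.cos_add, Real.cos_sub (x * Real.cos u - n * (π/2))]; ring
    rw [this, intervalIntegral.integral_const_mul]
    ring
  · apply Continuous.intervalIntegrable; fun_prop
  · apply Continuous.intervalIntegrable; fun_prop

noncomputable def fW (x : ℝ) : ℂ := √x * fS x * Complex.exp (Complex.I * ((π / 4 : ℝ) : ℂ))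

lemma fW_tendsto : Tendsto (fun x => (fW x).im) atTop (𝓝 0) ∧
    Tendsto (fun x => (fW x).re ^ 2) atTop (𝓝 (π / 4)) := by
  have h : Tendsto (fun x => fW x ^ 2) atTop (𝓝 ((π / 4 : ℝ) : ℂ)) := by
    have h1 := fS_tendsto.mul_const (Complex.exp (Complex.I * ((π / 4 : ℝ) : ℂ)) ^ 2)
    have e : Complex.exp (Complex.I * ((π / 4 : ℝ) : ℂ)) ^ 2 = Complex.I := by
      rw [← Complex.exp_nat_mul, show ((2:ℕ):ℂ) * (Complex.I * ((π / 4 : ℝ) : ℂ)) = π / 2 * Complex.I by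
        push_cast; ring, Complex.exp_pi_div_two_mul_I]
    rw [e] at h1
    have e2 : -(Complex.I * (π / 4)) * Complex.I = ((π / 4 : ℝ) : ℂ) := by
      push_cast; linear_combination (-(π / 4 : ℂ)) * Complex.I_sq
    rw [e2] at h1
    refine h1.congr' ?_
    filter_upwards [eventually_gt_atTop 0] with x hx
    have e3 : ((√x : ℝ) : ℂ) ^ 2 = x := by exact_mod_cast Real.sq_sqrt hx.le
    unfold fW
    rw [mul_pow, mul_pow, e, e3]
  have hn : Tendsto (fun x => (fW x).re ^ 2 + (fW x).im ^ 2) atTop (𝓝 (π / 4)) := by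
    have := h.norm
    rw [Complex.norm_real, Real.norm_eq_abs, abs_of_pos (by positivity)] at this
    refine this.congr fun x => ?_
    rw [norm_pow, Complex.sq_norm, Complex.normSq_apply]; ring
  have hr : Tendsto (fun x => (fW x).re ^ 2 - (fW x).im ^ 2) atTop (𝓝 (π / 4)) := by
    have := (Complex.continuous_re.tendsto _).comp h
    rw [Complex.ofReal_re] at this
    refine this.congr fun x => ?_
    simp [pow_two]
  constructor
  · have h2 : Tendsto (fun x => (fW x).im ^ 2) atTop (𝓝 0) := by
      have := (hn.sub hr).div_const 2
      rw [sub_self, zero_div] at this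
      refine this.congr fun x => by ring
    have h3 := h2.sqrt
    rw [Real.sqrt_zero] at h3
    simp only [Real.sqrt_sq_eq_abs] at h3
    exact (tendsto_zero_iff_abs_tendsto_zero _).2 h3
  · have := (hn.add hr).div_const 2
    rw [show (π / 4 + π / 4) / 2 = π / 4 by ring] at this
    refine this.congr fun x => by ring

lemma bJ_asymp (n : ℕ) : Tendsto (fun x => √x * besselJ n x - 2 * √2 / π *
    (Complex.exp (Complex.I * ((x - n * (π / 2) - π / 4 : ℝ) : ℂ)) * fW x).re) atTop (𝓝 0) := by
  obtain ⟨C, hC⟩ := fClose_all n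
  have t1 : Tendsto (fun x : ℝ => 2 / π * C / √x) atTop (𝓝 0) :=
    tendsto_const_nhds.div_atTop Real.tendsto_sqrt_atTop
  refine squeeze_zero_norm' ?_ t1
  filter_upwards [eventually_gt_atTop 0] with x hx
  have hs := Real.sqrt_pos.2 hx
  have hss := Real.mul_self_sqrt hx.le
  have h := hC x hx
  rw [fI_half] at h
  set E := Complex.exp (Complex.I * ((x - n * (π / 2) : ℝ) : ℂ)) with hE
  have e1 : Complex.exp (Complex.I * ((x - n * (π / 2) - π / 4 : ℝ) : ℂ)) * fW x = (√x : ℝ) * (E * fS x) := by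
    unfold fW
    have : Complex.exp (Complex.I * ((x - n * (π / 2) - π / 4 : ℝ) : ℂ)) *
        Complex.exp (Complex.I * ((π / 4 : ℝ) : ℂ)) = E := by
      rw [hE, ← Complex.exp_add]; congr 1; push_cast; ring
    rw [← this]; ring
  have e2 : √x * besselJ n x - 2 * √2 / π * (((√x : ℝ) : ℂ) * (E * fS x)).re =
      2 / π * √x * (E * (fI (fun u => Real.cos ((n:ℕ) * u)) x - √2 * fS x)).re := by
    rw [bJ_repr, ← hE, mul_sub, Complex.sub_re, Complex.re_ofReal_mul,
      show E * (((√2 : ℝ) : ℂ) * fS x) = ((√2 : ℝ) : ℂ) * (E * fS x) by ring, Complex.re_ofReal_mul]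
    ring
  rw [e1, e2, Real.norm_eq_abs, abs_mul, abs_of_pos (by positivity)]
  have hEn : ‖E‖ = 1 := by rw [hE, mul_comm, Complex.norm_exp_ofReal_mul_I]
  have h4 := Complex.abs_re_le_norm (E * (fI (fun u => Real.cos ((n:ℕ) * u)) x - √2 * fS x))
  rw [norm_mul, hEn, one_mul] at h4
  calc _ ≤ 2 / π * √x * (C / x) := by gcongr; exact h4.trans h
    _ = _ := by
      field_simp
      linear_combination C * hss

lemma exp_phase (n N : ℕ) (a : ℝ) : Complex.exp (Complex.I *
    (((a + n * (π / 2) + N * (2 * π)) - n * (π / 2) - π / 4 : ℝ) : ℂ)) =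
    Complex.exp (Complex.I * ((a - π / 4 : ℝ) : ℂ)) := by
  rw [show Complex.I * (((a + n * (π / 2) + N * (2 * π)) - n * (π / 2) - π / 4 : ℝ) : ℂ) =
    Complex.I * ((a - π / 4 : ℝ) : ℂ) + N * (2 * π * Complex.I) by push_cast; ring,
    Complex.exp_periodic.nat_mul N]

lemma tendsto_seq (n : ℕ) (a : ℝ) :
    Tendsto (fun N : ℕ => a + n * (π / 2) + N * (2 * π)) atTop atTop :=
  tendsto_atTop_add_const_left _ _
    (tendsto_natCast_atTop_atTop.atTop_mul_const (by positivity))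

lemma bJ_seq (n : ℕ) : Tendsto (fun N : ℕ => √(3 * π / 4 + n * (π / 2) + N * (2 * π)) *
    besselJ n (3 * π / 4 + n * (π / 2) + N * (2 * π))) atTop (𝓝 0) := by
  have h1 := (bJ_asymp n).comp (tendsto_seq n (3 * π / 4))
  have h2 := (fW_tendsto.1.comp (tendsto_seq n (3 * π / 4))).const_mul (-(2 * √2 / π))
  have h3 := h1.add h2
  rw [mul_zero, add_zero] at h3
  refine h3.congr fun N => ?_
  simp only [Function.comp]
  rw [exp_phase, show Complex.I * ((3 * π / 4 - π / 4 : ℝ) : ℂ) = π / 2 * Complex.I by push_cast; ring,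
    Complex.exp_pi_div_two_mul_I, Complex.I_mul_re]
  ring

lemma bJ_nontrivial (n : ℕ) (x₀ : ℝ) (h : ∀ x, x₀ ≤ x → besselJ n x = 0) : False := by
  have h1 := (bJ_asymp n).comp (tendsto_seq n (π / 4))
  have h2 := (fW_tendsto.2.comp (tendsto_seq n (π / 4)))
  have h3 := (h1.pow 2)
  have h4 := h2.mul_const ((2 * √2 / π) ^ 2)
  have h5 : Tendsto (fun N : ℕ => (fW (π / 4 + n * (π / 2) + N * (2 * π))).re ^ 2 *
      (2 * √2 / π) ^ 2) atTop (𝓝 (0 ^ 2)) := by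
    refine h3.congr' ?_
    filter_upwards [(tendsto_seq n (π / 4)).eventually_ge_atTop x₀] with N hN
    simp only [Function.comp]
    rw [exp_phase, h _ hN]
    simp only [sub_self, Complex.ofReal_zero, mul_zero, Complex.exp_zero, one_mul]
    ring
  have := tendsto_nhds_unique h4 h5
  have h6 : 0 < π / 4 * (2 * √2 / π) ^ 2 := by positivity
  rw [this] at h6
  norm_num at h6

lemma le_of_deriv {a b : ℝ} (hab : a ≤ b) {f f' : ℝ → ℝ} (hc : ContinuousOn f (Set.Icc a b))
    (hd : ∀ x ∈ Set.Ioo a b, HasDerivAt f (f' x) x) (h0 : ∀ x ∈ Set.Ioo a b, 0 ≤ f' x) :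
    f a ≤ f b := by
  refine monotoneOn_of_deriv_nonneg (convex_Icc a b) hc ?_ ?_ (Set.left_mem_Icc.2 hab)
    (Set.right_mem_Icc.2 hab) hab
  · rw [interior_Icc]; exact fun x hx => (hd x hx).differentiableAt.differentiableWithinAt
  · rw [interior_Icc]; intro x hx; rw [(hd x hx).deriv]; exact h0 x hx

lemma ode_unique (n : ℕ) (x₁ : ℝ) (hx₁ : 0 < x₁) (h1 : besselJ n x₁ = 0) (h2 : bZ n x₁ = 0)
    (X : ℝ) (hX : x₁ ≤ X) : besselJ n X = 0 := by
  set C := (1 + X ^ 2 + n ^ 2) / x₁ with hC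
  have hpos : ∀ x, x₁ ≤ x → 0 < x := fun x hx => hx₁.trans_le hx
  have hd : ∀ x, 0 < x → HasDerivAt
      (fun x => -((besselJ n x ^ 2 + bZ n x ^ 2) * Real.exp (-(C * x))))
      (-((2 * besselJ n x * (bZ n x / x) + 2 * bZ n x * (-(x ^ 2 - n ^ 2) / x * besselJ n x)) *
        Real.exp (-(C * x)) + (besselJ n x ^ 2 + bZ n x ^ 2) * (Real.exp (-(C * x)) * (-(C * 1))))) x := by
    intro x hx
    have a1 := (hasDerivAt_bJz n x hx).pow 2
    have a2 := (hasDerivAt_bZ n x hx).pow 2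
    have a3 := (((hasDerivAt_id x).const_mul C).neg).exp
    refine (((a1.add a2).mul a3).neg).congr_deriv ?_
    simp
  have := le_of_deriv hX (f := fun x => -((besselJ n x ^ 2 + bZ n x ^ 2) * Real.exp (-(C * x))))
    (fun x hx => (hd x (hpos x hx.1)).continuousAt.continuousWithinAt)
    (fun x hx => hd x (hpos x hx.1.le)) ?_
  · simp only [h1, h2] at this
    have e := Real.exp_pos (-(C * X))
    have h3 : (besselJ n X ^ 2 + bZ n X ^ 2) * Real.exp (-(C * X)) ≤ 0 := by
      norm_num at this ⊢; exact this
    have h4 : besselJ n X ^ 2 + bZ n X ^ 2 ≤ 0 := by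
      by_contra hcon; push Not at hcon
      have := mul_pos hcon e; linarith
    nlinarith [sq_nonneg (besselJ n X), sq_nonneg (bZ n X)]
  · intro x hx
    have hx0 := hpos x hx.1.le
    have e := Real.exp_pos (-(C * x))
    set J := besselJ n x
    set Z := bZ n x
    have key : 2 * J * Z * ((1 - (x ^ 2 - n ^ 2)) / x) ≤ C * (J ^ 2 + Z ^ 2) := by
      have k1 : |(1 - (x ^ 2 - (n:ℝ) ^ 2)) / x| ≤ C := by
        rw [abs_div, abs_of_pos hx0, hC]
        apply div_le_div₀ (by positivity) _ hx₁ hx.1.le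
        have : x ^ 2 ≤ X ^ 2 := pow_le_pow_left₀ hx0.le hx.2.le 2
        have := sq_nonneg (n:ℝ)
        have := sq_nonneg x
        rw [abs_le]; constructor <;> linarith
      have k2 : |2 * J * Z| ≤ J ^ 2 + Z ^ 2 := by
        rw [abs_le]; constructor <;> nlinarith [sq_nonneg (J + Z), sq_nonneg (J - Z)]
      calc _ ≤ |2 * J * Z * ((1 - (x ^ 2 - (n:ℝ) ^ 2)) / x)| := le_abs_self _
        _ = |2 * J * Z| * |((1 - (x ^ 2 - (n:ℝ) ^ 2)) / x)| := abs_mul _ _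
        _ ≤ (J ^ 2 + Z ^ 2) * C := by gcongr
        _ = _ := by ring
    have e2 : -((2 * J * (Z / x) + 2 * Z * (-(x ^ 2 - (n:ℝ) ^ 2) / x * J)) *
        Real.exp (-(C * x)) + (J ^ 2 + Z ^ 2) * (Real.exp (-(C * x)) * (-(C * 1)))) =
        (C * (J ^ 2 + Z ^ 2) - 2 * J * Z * ((1 - (x ^ 2 - n ^ 2)) / x)) * Real.exp (-(C * x)) := by
      ring
    rw [e2]
    exact mul_nonneg (by linarith) e.le

lemma bJ_pos (n : ℕ) (hn : 1 ≤ n) (x : ℝ) (hx : 0 < x) (hxn : x ≤ n) :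
    0 < besselJ n x * bZ n x := by
  have cJ : Continuous (besselJ n) :=
    continuous_iff_continuousAt.2 fun x => (hasDerivAt_bJ n x).continuousAt
  have cJ1 : Continuous (bJ1 n) :=
    continuous_iff_continuousAt.2 fun x => (hasDerivAt_bJ1 n x).continuousAt
  have cZ : Continuous (bZ n) := continuous_id.mul cJ1
  have hZ0 : bZ n 0 = 0 := by simp [bZ]
  have hJ0 := bJ_zero n hn
  have hmono : ∀ a b : ℝ, 0 ≤ a → a ≤ b → b ≤ n → besselJ n a * bZ n a ≤ besselJ n b * bZ n b := by
    intro a b ha hab hb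
    refine le_of_deriv hab (f := fun x => besselJ n x * bZ n x) (cJ.mul cZ).continuousOn
      (fun x hx => (hasDerivAt_bJz n x (ha.trans_lt hx.1)).mul (hasDerivAt_bZ n x (ha.trans_lt hx.1))) ?_
    intro x hx
    have hx0 : 0 < x := ha.trans_lt hx.1
    have hxn : x ≤ n := hx.2.le.trans hb
    have e : bZ n x / x * bZ n x + besselJ n x * (-(x ^ 2 - n ^ 2) / x * besselJ n x) =
      (bZ n x ^ 2 + (n ^ 2 - x ^ 2) * besselJ n x ^ 2) / x := by ring
    rw [e]
    have : 0 ≤ (n:ℝ) ^ 2 - x ^ 2 := by nlinarith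
    positivity
  have h0 := hmono 0 x le_rfl hx.le hxn
  rw [hJ0, zero_mul] at h0
  refine lt_of_le_of_ne h0 fun heq => ?_
  have hz : ∀ t ∈ Set.Icc 0 x, besselJ n t * bZ n t = 0 := by
    intro t ht
    have a1 := hmono 0 t le_rfl ht.1 (ht.2.trans hxn)
    have a2 := hmono t x ht.1 ht.2 hxn
    rw [hJ0, zero_mul] at a1
    linarith
  have hJz : ∀ t ∈ Set.Icc 0 x, besselJ n t = 0 := by
    intro t ht
    have := le_of_deriv ht.1 (f := fun x => -(besselJ n x ^ 2))
      (f' := fun _ => 0) (by fun_prop) (fun s hs => by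
        refine (((hasDerivAt_bJz n s hs.1).pow 2).neg).congr_deriv ?_
        have := hz s ⟨hs.1.le, hs.2.le.trans ht.2⟩
        have h2 : -((2:ℕ) * besselJ n s ^ (2 - 1) * (bZ n s / s)) =
          -(2 * (besselJ n s * bZ n s) / s) := by push_cast; ring
        rw [h2, this]; simp) (fun _ _ => le_rfl)
    simp only [hJ0] at this
    nlinarith [sq_nonneg (besselJ n t)]
  have hx2 : 0 < x / 2 := by positivity
  have hJ1z : bJ1 n (x / 2) = 0 := by
    have h1 := hasDerivAt_bJ n (x / 2)
    have h2 : HasDerivAt (besselJ n) 0 (x / 2) := by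
      refine (hasDerivAt_const (x / 2) (0:ℝ)).congr_of_eventuallyEq ?_
      filter_upwards [Icc_mem_nhds hx2 (by linarith : x / 2 < x)] with t ht using hJz t ht
    exact h1.unique h2
  exact bJ_nontrivial n (x / 2) fun X hX => ode_unique n (x / 2) hx2
    (hJz _ ⟨hx2.le, by linarith⟩) (by simp [bZ, hJ1z]) X hX

noncomputable def Om (n x : ℝ) : ℝ := √(x ^ 2 - n ^ 2) - n * Real.arccos (n / x)

noncomputable def psi (n x : ℝ) : ℝ := x ^ 2 * (x ^ 2 + 4 * n ^ 2) / (4 * (x ^ 2 - n ^ 2) ^ 3)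

noncomputable def hh (n x : ℝ) : ℝ := x ^ 2 / (2 * ((x ^ 2 - n ^ 2) * √(x ^ 2 - n ^ 2)))

lemma Q_pos {n x : ℝ} (hn : 0 < n) (hx : n < x) : 0 < x ^ 2 - n ^ 2 := by nlinarith

lemma sqrtQ_deriv {n x : ℝ} (hn : 0 < n) (hx : n < x) :
    HasDerivAt (fun x => √(x ^ 2 - n ^ 2)) (x / √(x ^ 2 - n ^ 2)) x := by
  have hQ := Q_pos hn hx
  refine (((hasDerivAt_pow 2 x).sub_const (n ^ 2)).sqrt hQ.ne').congr_deriv ?_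
  have := Real.sqrt_pos.2 hQ
  field_simp
  simp

lemma Om_deriv {n x : ℝ} (hn : 0 < n) (hx : n < x) :
    HasDerivAt (Om n) (√(x ^ 2 - n ^ 2) / x) x := by
  have hQ := Q_pos hn hx
  have hx0 : 0 < x := hn.trans hx
  have hs := Real.sqrt_pos.2 hQ
  have hss := Real.mul_self_sqrt hQ.le
  have h1 : n / x < 1 := (div_lt_one hx0).2 hx
  have h0 : 0 < n / x := by positivity
  have hd : HasDerivAt (fun x => n / x) (-n / x ^ 2) x := by
    refine ((hasDerivAt_const x n).div (hasDerivAt_id x) hx0.ne').congr_deriv ?_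
    simp
  have ha := ((Real.hasDerivAt_arccos (x := n / x) (by linarith) h1.ne).comp x hd).const_mul n
  refine ((sqrtQ_deriv hn hx).sub ha).congr_deriv ?_
  have e : √(1 - (n / x) ^ 2) = √(x ^ 2 - n ^ 2) / x := by
    rw [show 1 - (n / x) ^ 2 = (x ^ 2 - n ^ 2) / x ^ 2 by field_simp, Real.sqrt_div hQ.le,
      Real.sqrt_sq hx0.le]
  rw [e]
  field_simp
  nlinarith

lemma Om_cont {n : ℝ} (hn : 0 < n) : ContinuousOn (Om n) (Set.Ici n) := by
  unfold Om
  refine ContinuousOn.sub (by fun_prop) (ContinuousOn.mul continuousOn_const ?_)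
  refine Real.continuous_arccos.comp_continuousOn (ContinuousOn.div continuousOn_const continuousOn_id ?_)
  intro x hx
  exact (hn.trans_le hx).ne'

lemma Om_self {n : ℝ} (hn : 0 < n) : Om n n = 0 := by
  simp [Om, div_self hn.ne']

lemma Om_mono {n a b : ℝ} (hn : 0 < n) (ha : n ≤ a) (hab : a ≤ b) : Om n a ≤ Om n b := by
  refine le_of_deriv hab ((Om_cont hn).mono fun x hx => ha.trans hx.1)
    (fun x hx => Om_deriv hn (ha.trans_lt hx.1)) fun x hx => ?_
  have : 0 < x := hn.trans_le (ha.trans hx.1.le)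
  positivity

lemma Om_lower {n X : ℝ} (hn : 0 < n) (hX : n < X) :
    2 / 3 * √(2 * n) * ((X - n) * √(X - n)) / X ≤ Om n X := by
  have hX0 : 0 < X := hn.trans hX
  have := le_of_deriv hX.le (f := fun t => Om n t - 2 / 3 * √(2 * n) * ((t - n) * √(t - n)) / X)
    (f' := fun t => √(t ^ 2 - n ^ 2) / t - √(2 * n) * √(t - n) / X)
    (((Om_cont hn).mono fun x hx => hx.1).sub (by fun_prop)) ?_ ?_
  · simp only [Om_self hn, sub_self, zero_mul, mul_zero, zero_div] at this
    linarith
  · intro t ht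
    have hp : 0 < t - n := sub_pos.2 ht.1
    have hs := Real.sqrt_pos.2 hp
    have hss := Real.mul_self_sqrt hp.le
    have h1 : HasDerivAt (fun t => t - n) 1 t := (hasDerivAt_id t).sub_const n
    refine ((Om_deriv hn ht.1).sub (((h1.mul (h1.sqrt hp.ne')).const_mul
      (2 / 3 * √(2 * n))).div_const X)).congr_deriv ?_
    have e : (t - n) * (1 / (2 * √(t - n))) = √(t - n) / 2 := by
      field_simp; linarith
    rw [e]; ring
  · intro t ht
    have hp : 0 < t - n := sub_pos.2 ht.1
    have ht0 : 0 < t := hn.trans ht.1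
    rw [← Real.sqrt_mul (by positivity), sub_nonneg]
    apply div_le_div₀ (by positivity) _ ht0 ht.2.le
    apply Real.sqrt_le_sqrt
    nlinarith

lemma Om_pos {n x : ℝ} (hn : 0 < n) (hx : n < x) : 0 < Om n x := by
  refine lt_of_lt_of_le ?_ (Om_lower hn hx)
  have := sub_pos.2 hx
  have := hn.trans hx
  positivity

lemma Om_le_sqrt {n x : ℝ} (hn : 0 < n) : Om n x ≤ √(x ^ 2 - n ^ 2) := by
  unfold Om
  have := mul_nonneg hn.le (Real.arccos_nonneg (n / x))
  linarith

lemma Om_le_cube {n x : ℝ} (hn : 0 < n) (hx : n ≤ x) :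
    Om n x ≤ (x ^ 2 - n ^ 2) * √(x ^ 2 - n ^ 2) / (3 * n ^ 2) := by
  have := le_of_deriv hx (f := fun x => (x ^ 2 - n ^ 2) * √(x ^ 2 - n ^ 2) / (3 * n ^ 2) - Om n x)
    (f' := fun x => x * √(x ^ 2 - n ^ 2) / n ^ 2 - √(x ^ 2 - n ^ 2) / x)
    (ContinuousOn.sub (by fun_prop) ((Om_cont hn).mono fun x hx => hx.1)) ?_ ?_
  · simp only [Om_self hn, sub_self, zero_mul, zero_div] at this
    linarith
  · intro t ht
    have hQ := Q_pos hn ht.1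
    have hs := Real.sqrt_pos.2 hQ
    have hss := Real.mul_self_sqrt hQ.le
    have h1 : HasDerivAt (fun x => x ^ 2 - n ^ 2) (2 * t) t := by
      simpa using (hasDerivAt_pow 2 t).sub_const (n ^ 2)
    refine (((h1.mul (sqrtQ_deriv hn ht.1)).div_const (3 * n ^ 2)).sub (Om_deriv hn ht.1)).congr_deriv ?_
    have e : (t ^ 2 - n ^ 2) * (t / √(t ^ 2 - n ^ 2)) = t * √(t ^ 2 - n ^ 2) := by
      field_simp; linear_combination (-t) * hss
    rw [e]; ring
  · intro t ht
    have ht0 : 0 < t := hn.trans ht.1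
    have hs := Real.sqrt_nonneg (t ^ 2 - n ^ 2)
    have : t * √(t ^ 2 - n ^ 2) / n ^ 2 - √(t ^ 2 - n ^ 2) / t =
      √(t ^ 2 - n ^ 2) * (t ^ 2 - n ^ 2) / (n ^ 2 * t) := by field_simp
    rw [this]
    have := (Q_pos hn ht.1).le
    positivity

lemma psi_nonneg {n x : ℝ} (hn : 0 < n) (hx : n < x) : 0 ≤ psi n x := by
  have := Q_pos hn hx
  unfold psi; positivity

lemma psi_le {n x : ℝ} (hn : 0 < n) (hx : n < x) : psi n x ≤ 1 / Om n x ^ 2 := by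
  have hQ := Q_pos hn hx
  have hO := Om_pos hn hx
  have hs := Real.sqrt_pos.2 hQ
  have hss := Real.sq_sqrt hQ.le
  have h1 : Om n x ^ 2 ≤ x ^ 2 - n ^ 2 := by
    rw [← hss]; exact pow_le_pow_left₀ hO.le (Om_le_sqrt hn) 2
  have h2 : Om n x ^ 2 ≤ (x ^ 2 - n ^ 2) ^ 3 / (9 * n ^ 4) := by
    have := pow_le_pow_left₀ hO.le (Om_le_cube hn hx.le) 2
    rw [div_pow, mul_pow, hss] at this
    refine this.trans (le_of_eq ?_)
    field_simp
    ring
  rw [le_div_iff₀ (by positivity)]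
  unfold psi
  rw [div_mul_eq_mul_div, div_le_one (by positivity)]
  rcases le_total (x ^ 2) (4 * n ^ 2) with h | h
  · calc x ^ 2 * (x ^ 2 + 4 * n ^ 2) * Om n x ^ 2
        ≤ (4 * n ^ 2) * (4 * n ^ 2 + 4 * n ^ 2) * ((x ^ 2 - n ^ 2) ^ 3 / (9 * n ^ 4)) := by gcongr
      _ = 32 / 9 * (x ^ 2 - n ^ 2) ^ 3 := by field_simp; ring
      _ ≤ _ := by
        have : 0 < (x ^ 2 - n ^ 2) ^ 3 := by positivity
        linarith
  · calc x ^ 2 * (x ^ 2 + 4 * n ^ 2) * Om n x ^ 2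
        ≤ x ^ 2 * (x ^ 2 + 4 * n ^ 2) * (x ^ 2 - n ^ 2) := by gcongr
      _ ≤ 4 * (x ^ 2 - n ^ 2) ^ 2 * (x ^ 2 - n ^ 2) := by
        refine mul_le_mul_of_nonneg_right ?_ hQ.le
        nlinarith [sq_nonneg x, sq_nonneg (n ^ 2), mul_nonneg (sq_nonneg x) (sub_nonneg.2 h)]
      _ = _ := by ring

lemma hh_nonneg {n x : ℝ} (hn : 0 < n) (hx : n < x) : 0 ≤ hh n x := by
  have := Q_pos hn hx
  unfold hh; positivity

lemma hh_le {n x : ℝ} (hn : 0 < n) (hx : n < x) : hh n x ≤ 1 / Om n x := by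
  have hQ := Q_pos hn hx
  have hO := Om_pos hn hx
  have hss := Real.sq_sqrt hQ.le
  refine abs_le_of_sq_le_sq' ?_ (by positivity) |>.2
  rw [div_pow, one_pow]
  refine le_trans ?_ (psi_le hn hx)
  unfold hh psi
  rw [div_pow, mul_pow, mul_pow, hss, show 2 ^ 2 * ((x ^ 2 - n ^ 2) ^ 2 * (x ^ 2 - n ^ 2)) =
    4 * (x ^ 2 - n ^ 2) ^ 3 by ring]
  gcongr
  nlinarith [sq_nonneg x, sq_nonneg n, mul_nonneg (sq_nonneg x) (sq_nonneg n)]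

lemma Om_tendsto {n : ℝ} (hn : 0 < n) :
    Tendsto (fun x => Om n x - (x - n * (π / 2))) atTop (𝓝 0) := by
  have h1 : Tendsto (fun x => √(x ^ 2 - n ^ 2) - x) atTop (𝓝 0) := by
    have t1 : Tendsto (fun x : ℝ => n ^ 2 / x) atTop (𝓝 0) := tendsto_const_nhds.div_atTop tendsto_id
    refine squeeze_zero_norm' ?_ t1
    filter_upwards [eventually_gt_atTop n] with x hx
    have hQ := Q_pos hn hx
    have hx0 := hn.trans hx
    have hs := Real.sqrt_pos.2 hQ
    have hss := Real.sq_sqrt hQ.le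
    have hle : √(x ^ 2 - n ^ 2) ≤ x := by
      rw [Real.sqrt_le_left hx0.le]; nlinarith
    rw [Real.norm_eq_abs, abs_of_nonpos (by linarith), le_div_iff₀ hx0]
    nlinarith
  have h2 : Tendsto (fun x => n * (Real.arccos (n / x) - π / 2)) atTop (𝓝 0) := by
    have t1 : Tendsto (fun x : ℝ => n / x) atTop (𝓝 0) := tendsto_const_nhds.div_atTop tendsto_id
    have t2 := ((Real.continuous_arccos.tendsto 0).comp t1)
    have t3 := (t2.sub_const (π / 2)).const_mul n
    rw [Real.arccos_zero, sub_self, mul_zero] at t3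
    exact t3
  have h3 := h1.sub h2
  rw [sub_zero] at h3
  refine h3.congr fun x => ?_
  unfold Om; ring

lemma gfun_Om {n t : ℝ} (hn : 0 ≤ n) (ht : 0 < t) : π * (t * gfun (n / t)) = Om n t := by
  unfold gfun Om
  have e : √(t ^ 2 - n ^ 2) = t * √(1 - (n / t) ^ 2) := by
    rw [show t ^ 2 - n ^ 2 = t ^ 2 * (1 - (n / t) ^ 2) by field_simp, Real.sqrt_mul (sq_nonneg t),
      Real.sqrt_sq ht.le]
  rw [e]
  have := Real.pi_pos
  field_simp

lemma prufer {c x₁ : ℝ} (hx₁ : c < x₁) {f g f' g' : ℝ → ℝ}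
    (hf : ∀ x, c < x → HasDerivAt f (f' x) x) (hg : ∀ x, c < x → HasDerivAt g (g' x) x)
    (cf : ContinuousOn f' (Set.Ioi c)) (cg : ContinuousOn g' (Set.Ioi c))
    (h0 : ∀ x, c < x → 0 < f x ^ 2 + g x ^ 2) (θ₁ : ℝ)
    (h1 : f x₁ = √(f x₁ ^ 2 + g x₁ ^ 2) * Real.cos θ₁)
    (h2 : g x₁ = -(√(f x₁ ^ 2 + g x₁ ^ 2) * Real.sin θ₁)) :
    ∃ θ : ℝ → ℝ, θ x₁ = θ₁ ∧ ∀ x, c < x →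
      HasDerivAt θ ((g x * f' x - f x * g' x) / (f x ^ 2 + g x ^ 2)) x ∧
      f x = √(f x ^ 2 + g x ^ 2) * Real.cos (θ x) ∧
      g x = -(√(f x ^ 2 + g x ^ 2) * Real.sin (θ x)) := by
  set q : ℝ → ℝ := fun x => (g x * f' x - f x * g' x) / (f x ^ 2 + g x ^ 2) with hq
  have cq : ContinuousOn q (Set.Ioi c) := by
    have cf0 : ContinuousOn f (Set.Ioi c) := fun x hx => (hf x hx).continuousAt.continuousWithinAt
    have cg0 : ContinuousOn g (Set.Ioi c) := fun x hx => (hg x hx).continuousAt.continuousWithinAt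
    exact ContinuousOn.div (by fun_prop) (by fun_prop) fun x hx => (h0 x hx).ne'
  set θ : ℝ → ℝ := fun x => θ₁ + ∫ t in x₁..x, q t with hθ
  have dθ : ∀ x, c < x → HasDerivAt θ (q x) x := by
    intro x hx
    have hsub : Set.uIcc x₁ x ⊆ Set.Ioi c := by
      intro t ht
      exact lt_of_lt_of_le (lt_min hx₁ hx) ht.1
    refine (intervalIntegral.integral_hasDerivAt_right (cq.mono hsub).intervalIntegrable
      (cq.stronglyMeasurableAtFilter isOpen_Ioi x hx)
      (cq.continuousAt (isOpen_Ioi.mem_nhds hx))).const_add θ₁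
  have dr : ∀ x, c < x → HasDerivAt (fun x => √(f x ^ 2 + g x ^ 2))
      ((f x * f' x + g x * g' x) / √(f x ^ 2 + g x ^ 2)) x := by
    intro x hx
    have hs := Real.sqrt_pos.2 (h0 x hx)
    refine ((((hf x hx).pow 2).add ((hg x hx).pow 2)).sqrt (h0 x hx).ne').congr_deriv ?_
    simp only [Pi.add_apply, Pi.pow_apply]
    field_simp
    norm_num
    ring
  have key : ∀ (A B : ℝ → ℝ), (∀ x, c < x → HasDerivAt A (-(B x * q x)) x) →
      (∀ x, c < x → HasDerivAt B (A x * q x) x) → ∀ x, c < x →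
      (f x * B x + g x * A x) / √(f x ^ 2 + g x ^ 2) =
      (f x₁ * B x₁ + g x₁ * A x₁) / √(f x₁ ^ 2 + g x₁ ^ 2) := by
    intro A B hA hB x hx
    have hd : ∀ x, c < x → HasDerivAt (fun x => (f x * B x + g x * A x) / √(f x ^ 2 + g x ^ 2)) 0 x := by
      intro x hx
      have hs := Real.sqrt_pos.2 (h0 x hx)
      have hss := Real.sq_sqrt (h0 x hx).le
      refine ((((hf x hx).mul (hB x hx)).add ((hg x hx).mul (hA x hx))).div (dr x hx) hs.ne').congr_deriv ?_
      have e : q x * (f x ^ 2 + g x ^ 2) = g x * f' x - f x * g' x := by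
        rw [hq]; exact div_mul_cancel₀ _ (h0 x hx).ne'
      simp only [Pi.add_apply, Pi.mul_apply]
      rw [div_eq_zero_iff]; left
      rw [← mul_right_inj' hs.ne', mul_zero]
      have : √(f x ^ 2 + g x ^ 2) * ((f x * f' x + g x * g' x) / √(f x ^ 2 + g x ^ 2)) =
        (f x * f' x + g x * g' x) := by field_simp
      linear_combination (f' x * B x + f x * (A x * q x) + (g' x * A x + g x * -(B x * q x))) * hss
        - (f x * B x + g x * A x) * this + (f x * A x - g x * B x) * e
    exact isOpen_Ioi.is_const_of_deriv_eq_zero (convex_Ioi c).isPreconnected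
      (fun x hx => (hd x hx).differentiableAt.differentiableWithinAt)
      (fun x hx => (hd x hx).deriv) hx hx₁
  have hθ1 : θ x₁ = θ₁ := by simp [hθ]
  refine ⟨θ, hθ1, fun x hx => ⟨dθ x hx, ?_⟩⟩
  have k1 := key (fun x => Real.cos (θ x)) (fun x => Real.sin (θ x))
    (fun x hx => (dθ x hx).cos.congr_deriv (by ring)) (fun x hx => (dθ x hx).sin) x hx
  have k2 := key (fun x => -Real.sin (θ x)) (fun x => Real.cos (θ x))
    (fun x hx => (dθ x hx).sin.neg.congr_deriv (by ring))
    (fun x hx => (dθ x hx).cos) x hx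
  simp only [hθ1] at k1 k2
  have hs1 := Real.sqrt_pos.2 (h0 x₁ hx₁)
  have hs := Real.sqrt_pos.2 (h0 x hx)
  set r := √(f x ^ 2 + g x ^ 2)
  set r1 := √(f x₁ ^ 2 + g x₁ ^ 2)
  have sc1 := Real.sin_sq_add_cos_sq θ₁
  have sc := Real.sin_sq_add_cos_sq (θ x)
  have e1 : (f x₁ * Real.sin θ₁ + g x₁ * Real.cos θ₁) / r1 = 0 := by
    rw [h1, h2]; field_simp; ring
  have e2 : (f x₁ * Real.cos θ₁ + g x₁ * -Real.sin θ₁) / r1 = 1 := by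
    rw [h1, h2, div_eq_one_iff_eq hs1.ne']; linear_combination r1 * sc1
  rw [e1, div_eq_zero_iff, or_iff_left hs.ne'] at k1
  rw [e2, div_eq_one_iff_eq hs.ne'] at k2
  constructor
  · linear_combination Real.sin (θ x) * k1 + Real.cos (θ x) * k2 - f x * sc
  · linear_combination Real.cos (θ x) * k1 - Real.sin (θ x) * k2 - g x * sc

structure BS (n : ℝ) (y z : ℝ → ℝ) : Prop where
  hn : 8 ≤ n
  hy : ∀ x, 0 < x → HasDerivAt y (z x / x) x
  hz : ∀ x, 0 < x → HasDerivAt z (-(x ^ 2 - n ^ 2) / x * y x) x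
  yn : 0 < y n
  zn : 0 < z n

lemma BS.ypos {n : ℝ} {y z : ℝ → ℝ} (H : BS n y z) {X : ℝ} (hX : n ≤ X)
    (hX3 : (X - n) ^ 3 < 3 * n) : 0 < y X := by
  by_contra hcon
  push Not at hcon
  have hn0 : 0 < n := by linarith [H.hn]
  have cy : ContinuousOn y (Set.Icc n X) := fun x hx =>
    (H.hy x (hn0.trans_le hx.1)).continuousAt.continuousWithinAt
  -- first zero
  have hcl : IsCompact {x | x ∈ Set.Icc n X ∧ y x ≤ 0} := by
    have : {x | x ∈ Set.Icc n X ∧ y x ≤ 0} = Set.Icc n X ∩ y ⁻¹' (Set.Iic 0) := rfl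
    rw [this]
    exact (isCompact_Icc).of_isClosed_subset
      (cy.preimage_isClosed_of_isClosed isClosed_Icc isClosed_Iic) Set.inter_subset_left
  obtain ⟨x0, ⟨⟨hx0, hx0X⟩, hy0⟩, hmin⟩ := hcl.exists_isLeast ⟨X, ⟨hX, le_rfl⟩, hcon⟩
  have hpos : ∀ x, n ≤ x → x < x0 → 0 < y x := by
    intro x h1 h2
    by_contra h; push Not at h
    exact absurd (hmin ⟨⟨h1, h2.le.trans hx0X⟩, h⟩) (not_le.2 h2)
  have hwpos : ∀ x, n ≤ x → x ≤ x0 → 0 < 1 - (x - n) ^ 3 / (3 * n) := by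
    intro x h1 h2
    rw [sub_pos, div_lt_one (by positivity)]
    exact lt_of_le_of_lt (pow_le_pow_left₀ (by linarith) (by linarith) 3) hX3
  have dw : ∀ x, HasDerivAt (fun x => 1 - (x - n) ^ 3 / (3 * n)) (-(x - n) ^ 2 / n) x := by
    intro x
    have h1 : HasDerivAt (fun t => t - n) 1 x := (hasDerivAt_id x).sub_const n
    refine (((h1.pow 3).div_const (3 * n)).const_sub 1).congr_deriv ?_
    field_simp; norm_num; ring
  have dzw : ∀ x, HasDerivAt (fun x => -(x * (x - n) ^ 2) / n)
      (-((x - n) ^ 2 + 2 * x * (x - n)) / n) x := by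
    intro x
    have h1 : HasDerivAt (fun t => t - n) 1 x := (hasDerivAt_id x).sub_const n
    refine ((((hasDerivAt_id x).mul (h1.pow 2)).neg).div_const n).congr_deriv ?_
    simp; ring
  have hW : ∀ X', n ≤ X' → X' ≤ x0 →
      z n ≤ z X' * (1 - (X' - n) ^ 3 / (3 * n)) - y X' * (-(X' * (X' - n) ^ 2) / n) := by
    intro X' h1 h2
    have hd : ∀ x, n ≤ x → HasDerivAt
        (fun x => z x * (1 - (x - n) ^ 3 / (3 * n)) - y x * (-(x * (x - n) ^ 2) / n))
        (y x * (((x - n) ^ 2 + 2 * x * (x - n)) / n -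
          (x ^ 2 - n ^ 2) / x * (1 - (x - n) ^ 3 / (3 * n)))) x := by
      intro x hx
      have hx0 : 0 < x := hn0.trans_le hx
      refine (((H.hz x hx0).mul (dw x)).sub ((H.hy x hx0).mul (dzw x))).congr_deriv ?_
      field_simp; ring
    have := le_of_deriv h1 (fun x hx => (hd x hx.1).continuousAt.continuousWithinAt)
      (fun x hx => hd x hx.1.le) ?_
    · simpa using this
    · intro x hx
      refine mul_nonneg (hpos x hx.1.le (hx.2.trans_le h2)).le ?_
      have hxp : 0 < x := hn0.trans hx.1
      have hxn := sub_pos.2 hx.1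
      have a1 : (x ^ 2 - n ^ 2) / x * (1 - (x - n) ^ 3 / (3 * n)) ≤ (x ^ 2 - n ^ 2) / x * 1 := by
        have := Q_pos hn0 hx.1
        gcongr
        have : 0 ≤ (x - n) ^ 3 / (3 * n) := by positivity
        linarith
      have a2 : (x ^ 2 - n ^ 2) / x * 1 ≤ 2 * (x - n) := by
        rw [mul_one, div_le_iff₀ hxp]; nlinarith [hx.1]
      have a3 : 2 * (x - n) ≤ ((x - n) ^ 2 + 2 * x * (x - n)) / n := by
        rw [le_div_iff₀ hn0]; nlinarith [sq_nonneg (x - n), mul_pos hxn hxn]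
      linarith
  have := le_of_deriv hx0 (f := fun x => y x / (1 - (x - n) ^ 3 / (3 * n)))
    (f' := fun x => (z x / x * (1 - (x - n) ^ 3 / (3 * n)) - y x * (-(x - n) ^ 2 / n)) /
      (1 - (x - n) ^ 3 / (3 * n)) ^ 2) ?_ ?_ ?_
  · have h1 : y x0 / (1 - (x0 - n) ^ 3 / (3 * n)) ≤ 0 :=
      div_nonpos_of_nonpos_of_nonneg hy0 (hwpos x0 hx0 le_rfl).le
    simp at this
    linarith [H.yn]
  · intro x hx
    exact ((H.hy x (hn0.trans_le hx.1)).div (dw x) (hwpos x hx.1 hx.2).ne').continuousAt.continuousWithinAt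
  · intro x hx
    exact (H.hy x (hn0.trans hx.1)).div (dw x) (hwpos x hx.1.le hx.2.le).ne'
  · intro x hx
    have hxp : 0 < x := hn0.trans hx.1
    refine div_nonneg ?_ (sq_nonneg _)
    have h := hW x hx.1.le hx.2.le
    have e : z x / x * (1 - (x - n) ^ 3 / (3 * n)) - y x * (-(x - n) ^ 2 / n) =
      (z x * (1 - (x - n) ^ 3 / (3 * n)) - y x * (-(x * (x - n) ^ 2) / n)) / x := by
      field_simp
    rw [e]
    exact div_nonneg (H.zn.le.trans h) hxp.le

lemma exists_x2 {n : ℝ} (hn : 8 ≤ n) : ∃ x2, n < x2 ∧ (x2 - n) ^ 3 < 3 * n ∧ 1 ≤ Om n x2 := by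
  have hn0 : 0 < n := by linarith
  set d : ℝ := (2 * n) ^ ((1:ℝ) / 3) with hd
  have hdp : 0 < d := by positivity
  have hd3 : d ^ 3 = 2 * n := by
    rw [hd, ← Real.rpow_natCast, ← Real.rpow_mul (by positivity)]; norm_num
  have hdn : 3 * d ≤ n := by
    by_contra h; push Not at h
    have : n ^ 3 < (3 * d) ^ 3 := pow_lt_pow_left₀ h hn0.le (by norm_num)
    rw [mul_pow, hd3] at this
    have h2 : 64 ≤ n ^ 2 := by nlinarith
    nlinarith [mul_le_mul_of_nonneg_left h2 hn0.le]
  refine ⟨n + d, by linarith, by simp only [add_sub_cancel_left]; linarith, ?_⟩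
  refine le_trans ?_ (Om_lower hn0 (by linarith : n < n + d))
  rw [add_sub_cancel_left, ← hd3, le_div_iff₀ (by linarith)]
  have : √(d ^ 3) * √d = d ^ 2 := by
    rw [← Real.sqrt_mul (by positivity), show d ^ 3 * d = (d ^ 2) ^ 2 by ring, Real.sqrt_sq (by positivity)]
  have e : 2 / 3 * √(d ^ 3) * (d * √d) = 2 / 3 * d ^ 3 := by
    linear_combination 2 / 3 * d * this
  rw [e]
  linarith

noncomputable def bb (n : ℝ) (y z : ℝ → ℝ) (x : ℝ) : ℝ := z x / √(x ^ 2 - n ^ 2) + hh n x * y x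

lemma hh_deriv {n x : ℝ} (hn : 0 < n) (hx : n < x) :
    HasDerivAt (hh n) (-(√(x ^ 2 - n ^ 2) / x) * (psi n x + hh n x ^ 2)) x := by
  have hQ := Q_pos hn hx
  have hx0 := hn.trans hx
  have hs := Real.sqrt_pos.2 hQ
  have hss := Real.sq_sqrt hQ.le
  have h1 : HasDerivAt (fun x => x ^ 2 - n ^ 2) (2 * x) x := by
    simpa using (hasDerivAt_pow 2 x).sub_const (n ^ 2)
  have h2 : HasDerivAt (fun x => x ^ 2) (2 * x) x := by simpa using hasDerivAt_pow 2 x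
  refine (h2.div ((h1.mul (sqrtQ_deriv hn hx)).const_mul 2) (by
    simp only [Pi.mul_apply]; positivity)).congr_deriv ?_
  unfold psi hh
  simp only [Pi.mul_apply]
  set S := √(x ^ 2 - n ^ 2) with hS
  rw [← hss]
  have hn2 : n ^ 2 = x ^ 2 - S ^ 2 := by linarith
  rw [hn2]
  field_simp
  ring

lemma bb_deriv {n : ℝ} {y z : ℝ → ℝ} (H : BS n y z) {x : ℝ} (hx : n < x) :
    HasDerivAt (bb n y z)
      (-(√(x ^ 2 - n ^ 2) / x) * ((1 + psi n x) * y x + hh n x * bb n y z x)) x := by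
  have hn : 0 < n := by linarith [H.hn]
  have hQ := Q_pos hn hx
  have hx0 := hn.trans hx
  have hs := Real.sqrt_pos.2 hQ
  have hss := Real.sq_sqrt hQ.le
  refine (((H.hz x hx0).div (sqrtQ_deriv hn hx) hs.ne').add
    ((hh_deriv hn hx).mul (H.hy x hx0))).congr_deriv ?_
  unfold bb
  have e : hh n x = x ^ 2 / (2 * (√(x ^ 2 - n ^ 2) ^ 3)) := by
    unfold hh; congr 2; linear_combination (-√(x ^ 2 - n ^ 2)) * hss
  rw [e]
  set S := √(x ^ 2 - n ^ 2) with hS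
  rw [hss.symm]
  field_simp
  ring

lemma y_deriv {n : ℝ} {y z : ℝ → ℝ} (H : BS n y z) {x : ℝ} (hx : n < x) :
    HasDerivAt y (√(x ^ 2 - n ^ 2) / x * (bb n y z x - hh n x * y x)) x := by
  have hn : 0 < n := by linarith [H.hn]
  have hQ := Q_pos hn hx
  have hx0 := hn.trans hx
  have hs := Real.sqrt_pos.2 hQ
  refine (H.hy x hx0).congr_deriv ?_
  unfold bb
  field_simp
  ring

noncomputable def EE (n : ℝ) (y z : ℝ → ℝ) (x : ℝ) : ℝ :=
  √(x ^ 2 - n ^ 2) * (y x ^ 2 + bb n y z x ^ 2)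

lemma EE_deriv {n : ℝ} {y z : ℝ → ℝ} (H : BS n y z) {x : ℝ} (hx : n < x) :
    HasDerivAt (EE n y z) (-(√(x ^ 2 - n ^ 2) / x) * psi n x *
      (√(x ^ 2 - n ^ 2) * (2 * y x * bb n y z x))) x := by
  have hn : 0 < n := by linarith [H.hn]
  have hQ := Q_pos hn hx
  have hx0 := hn.trans hx
  have hs := Real.sqrt_pos.2 hQ
  have hss := Real.sq_sqrt hQ.le
  refine ((sqrtQ_deriv hn hx).mul (((y_deriv H hx).pow 2).add ((bb_deriv H hx).pow 2))).congr_deriv ?_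
  simp only [Pi.add_apply, Pi.pow_apply]
  have e : hh n x = x ^ 2 / (2 * (√(x ^ 2 - n ^ 2) ^ 3)) := by
    unfold hh; congr 2; linear_combination (-√(x ^ 2 - n ^ 2)) * hss
  rw [e]
  set S := √(x ^ 2 - n ^ 2) with hS
  set b := bb n y z x
  field_simp
  norm_num
  ring

lemma EE_mono {n : ℝ} {y z : ℝ → ℝ} (H : BS n y z) {a b : ℝ} (ha : n < a) (hab : a ≤ b) :
    EE n y z a * Real.exp (-(1 / Om n a)) ≤ EE n y z b * Real.exp (-(1 / Om n b)) := by
  have hn : 0 < n := by linarith [H.hn]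
  have hd : ∀ x, n < x → HasDerivAt (fun x => EE n y z x * Real.exp (-(1 / Om n x)))
      ((-(√(x ^ 2 - n ^ 2) / x) * psi n x * (√(x ^ 2 - n ^ 2) * (2 * y x * bb n y z x)) +
        EE n y z x * (√(x ^ 2 - n ^ 2) / x * (1 / Om n x ^ 2))) * Real.exp (-(1 / Om n x))) x := by
    intro x hx
    have hO := Om_pos hn hx
    have h1 : HasDerivAt (fun x => -(1 / Om n x)) (√(x ^ 2 - n ^ 2) / x * (1 / Om n x ^ 2)) x := by
      refine (((hasDerivAt_const x (1:ℝ)).div (Om_deriv hn hx) hO.ne').neg).congr_deriv ?_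
      ring
    refine ((EE_deriv H hx).mul h1.exp).congr_deriv ?_
    ring
  refine le_of_deriv hab (fun x hx => (hd x (ha.trans_le hx.1)).continuousAt.continuousWithinAt)
    (fun x hx => hd x (ha.trans hx.1)) fun x hx => ?_
  have hx' := ha.trans hx.1
  refine mul_nonneg ?_ (Real.exp_pos _).le
  have hx0 := hn.trans hx'
  have hp : 0 ≤ √(x ^ 2 - n ^ 2) / x := by positivity
  have hs := Real.sqrt_nonneg (x ^ 2 - n ^ 2)
  have hpsi := psi_nonneg hn hx'
  have hpsi2 := psi_le hn hx'
  have hE : 0 ≤ EE n y z x := by unfold EE; positivity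
  have h1 : √(x ^ 2 - n ^ 2) * (2 * y x * bb n y z x) ≤ EE n y z x := by
    unfold EE
    refine mul_le_mul_of_nonneg_left ?_ hs
    nlinarith [sq_nonneg (y x - bb n y z x)]
  have h2 : psi n x * (√(x ^ 2 - n ^ 2) * (2 * y x * bb n y z x)) ≤ 1 / Om n x ^ 2 * EE n y z x :=
    (mul_le_mul_of_nonneg_left h1 hpsi).trans (mul_le_mul_of_nonneg_right hpsi2 hE)
  have h3 := mul_le_mul_of_nonneg_left h2 hp
  linarith

lemma EE_pos {n : ℝ} {y z : ℝ → ℝ} (H : BS n y z) {x2 : ℝ} (h2 : n < x2)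
    (hy2 : ∀ x, n ≤ x → x ≤ x2 → 0 < y x) {x : ℝ} (hx : n < x) : 0 < EE n y z x := by
  have hn : 0 < n := by linarith [H.hn]
  have hm : n < min x x2 := lt_min hx h2
  have h1 := EE_mono H hm (min_le_left x x2)
  have hy := hy2 _ hm.le (min_le_right x x2)
  have hs := Real.sqrt_pos.2 (Q_pos hn hm)
  have h3 : 0 < EE n y z (min x x2) := by unfold EE; positivity
  have h4 := (mul_pos h3 (Real.exp_pos (-(1 / Om n (min x x2))))).trans_le h1
  exact pos_of_mul_pos_left h4 (Real.exp_pos _).le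

lemma stay_lt {s : Set ℝ} (hs : IsPreconnected s) {f : ℝ → ℝ} (hf : ContinuousOn f s) {v : ℝ}
    (h : ∀ x ∈ s, f x ≠ v) {a b : ℝ} (ha : a ∈ s) (hb : b ∈ s) (hfa : f a < v) : f b < v := by
  by_contra hcon
  push Not at hcon
  obtain ⟨x, hx, e⟩ := hs.intermediate_value ha hb hf ⟨hfa.le, hcon⟩
  exact h x hx e

lemma stay_gt {s : Set ℝ} (hs : IsPreconnected s) {f : ℝ → ℝ} (hf : ContinuousOn f s) {v : ℝ}
    (h : ∀ x ∈ s, f x ≠ v) {a b : ℝ} (ha : a ∈ s) (hb : b ∈ s) (hfa : v < f a) : v < f b := by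
  by_contra hcon
  push Not at hcon
  obtain ⟨x, hx, e⟩ := hs.intermediate_value hb ha hf ⟨hcon, hfa.le⟩
  exact h x hx e

lemma init_angle {a b : ℝ} (ha : 0 < a) : a = √(a ^ 2 + b ^ 2) * Real.cos (-Real.arctan (b / a)) ∧
    b = -(√(a ^ 2 + b ^ 2) * Real.sin (-Real.arctan (b / a))) := by
  have e : √(1 + (b / a) ^ 2) = √(a ^ 2 + b ^ 2) / a := by
    rw [show 1 + (b / a) ^ 2 = (a ^ 2 + b ^ 2) / a ^ 2 by field_simp, Real.sqrt_div (by positivity),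
      Real.sqrt_sq ha.le]
  have hr : 0 < √(a ^ 2 + b ^ 2) := Real.sqrt_pos.2 (by positivity)
  rw [Real.cos_neg, Real.sin_neg, Real.cos_arctan, Real.sin_arctan, e]
  constructor
  · field_simp
  · field_simp

lemma cont_psi {n : ℝ} (hn : 0 < n) : ContinuousOn (psi n) (Set.Ioi n) := by
  unfold psi
  refine ContinuousOn.div (by fun_prop) (by fun_prop) fun x hx => ?_
  have := Q_pos hn hx
  positivity

theorem wkb {n : ℝ} {y z : ℝ → ℝ} (H : BS n y z)
    (hseq : Tendsto (fun N : ℕ => √(3 * π / 4 + n * (π / 2) + N * (2 * π)) *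
      y (3 * π / 4 + n * (π / 2) + N * (2 * π))) atTop (𝓝 0)) :
    ∃ x2 : ℝ, ∃ θ : ℝ → ℝ, n < x2 ∧ (∀ x, n ≤ x → x ≤ x2 → 0 < y x) ∧
      ContinuousOn θ (Set.Ioi n) ∧
      (∀ x, n < x → 0 < y x ^ 2 + bb n y z x ^ 2 ∧
        y x = √(y x ^ 2 + bb n y z x ^ 2) * Real.cos (θ x) ∧
        bb n y z x = -(√(y x ^ 2 + bb n y z x ^ 2) * Real.sin (θ x))) ∧
      -(π / 2) < θ x2 ∧ θ x2 < π / 2 ∧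
      ∀ x, n < x → Om n x - π / 4 - 1 / Om n x ≤ θ x ∧ θ x ≤ Om n x - π / 4 := by
  have hn : 0 < n := by linarith [H.hn]
  have hpi := Real.pi_gt_three
  obtain ⟨x2, hx2, hx23, hO2⟩ := exists_x2 H.hn
  have hy2 : ∀ x, n ≤ x → x ≤ x2 → 0 < y x := fun x h1 h2 => H.ypos h1
    (lt_of_le_of_lt (pow_le_pow_left₀ (by linarith) (by linarith) 3) hx23)
  have hE : ∀ x, n < x → 0 < EE n y z x := fun x hx => EE_pos H hx2 hy2 hx
  have hr : ∀ x, n < x → 0 < y x ^ 2 + bb n y z x ^ 2 := fun x hx =>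
    pos_of_mul_pos_right (hE x hx) (Real.sqrt_nonneg _)
  have cy : ContinuousOn y (Set.Ioi n) := fun x hx => (y_deriv H hx).continuousAt.continuousWithinAt
  have cb : ContinuousOn (bb n y z) (Set.Ioi n) :=
    fun x hx => (bb_deriv H hx).continuousAt.continuousWithinAt
  have chh : ContinuousOn (hh n) (Set.Ioi n) :=
    fun x hx => (hh_deriv hn hx).continuousAt.continuousWithinAt
  have cp : ContinuousOn (fun x => √(x ^ 2 - n ^ 2) / x) (Set.Ioi n) :=
    ContinuousOn.div (by fun_prop) (by fun_prop) fun x hx => (hn.trans hx).ne'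
  have cpsi := cont_psi hn
  obtain ⟨i1, i2⟩ := init_angle (b := bb n y z x2) (hy2 x2 hx2.le le_rfl)
  obtain ⟨θ, hθ2, hθ⟩ := prufer hx2 (fun x hx => y_deriv H hx) (fun x hx => bb_deriv H hx)
    (by fun_prop) (by fun_prop) hr _ i1 i2
  have cθ : ContinuousOn θ (Set.Ioi n) := fun x hx => (hθ x hx).1.continuousAt.continuousWithinAt
  have b1 : -(π / 2) < θ x2 := by
    rw [hθ2]; linarith [Real.arctan_lt_pi_div_two (bb n y z x2 / y x2)]
  have b2 : θ x2 < π / 2 := by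
    rw [hθ2]; linarith [Real.neg_pi_div_two_lt_arctan (bb n y z x2 / y x2)]
  have hθ' : ∀ x, n < x → HasDerivAt θ (√(x ^ 2 - n ^ 2) / x *
      (1 + psi n x * (y x ^ 2 / (y x ^ 2 + bb n y z x ^ 2)))) x := by
    intro x hx
    refine (hθ x hx).1.congr_deriv ?_
    have := hr x hx
    have hx0 := hn.trans hx
    field_simp
    ring
  -- the lower bound on (n, x2]
  have hlow : ∀ x, n < x → x ≤ x2 → -(π / 2) < θ x := by
    intro x h1 h2
    refine stay_gt (s := Set.Icc x x2) isPreconnected_Icc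
      (cθ.mono fun t ht => h1.trans_le ht.1) ?_ (Set.right_mem_Icc.2 h2) (Set.left_mem_Icc.2 h2) b1
    intro t ht e
    have := (hθ t (h1.trans_le ht.1)).2.1
    rw [e, Real.cos_neg, Real.cos_pi_div_two, mul_zero] at this
    exact (hy2 t (h1.le.trans ht.1) ht.2).ne' this
  set ε : ℝ → ℝ := fun x => θ x - Om n x + π / 4 with hε
  have e1 : ∀ a b, n < a → a ≤ b → ε a ≤ ε b := by
    intro a b ha hab
    have hd : ∀ x, n < x → HasDerivAt ε (√(x ^ 2 - n ^ 2) / x *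
      (psi n x * (y x ^ 2 / (y x ^ 2 + bb n y z x ^ 2)))) x := by
      intro x hx
      refine (((hθ' x hx).sub (Om_deriv hn hx)).add_const (π / 4)).congr_deriv ?_
      ring
    refine le_of_deriv hab (fun x hx => (hd x (ha.trans_le hx.1)).continuousAt.continuousWithinAt)
      (fun x hx => hd x (ha.trans hx.1)) fun x hx => ?_
    have hx' := ha.trans hx.1
    have := hn.trans hx'
    have := psi_nonneg hn hx'
    positivity
  have e2 : ∀ a b, n < a → a ≤ b → ε b + 1 / Om n b ≤ ε a + 1 / Om n a := by
    intro a b ha hab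
    have hd : ∀ x, n < x → HasDerivAt (fun x => -(ε x + 1 / Om n x)) (√(x ^ 2 - n ^ 2) / x *
      (1 / Om n x ^ 2 - psi n x * (y x ^ 2 / (y x ^ 2 + bb n y z x ^ 2)))) x := by
      intro x hx
      have hO := Om_pos hn hx
      refine (((((hθ' x hx).sub (Om_deriv hn hx)).add_const (π / 4)).add
        ((hasDerivAt_const x (1:ℝ)).div (Om_deriv hn hx) hO.ne')).neg).congr_deriv ?_
      ring
    have := le_of_deriv hab (fun x hx => (hd x (ha.trans_le hx.1)).continuousAt.continuousWithinAt)
      (fun x hx => hd x (ha.trans hx.1)) ?_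
    · linarith
    intro x hx
    have hx' := ha.trans hx.1
    have := hn.trans hx'
    have h1 := psi_nonneg hn hx'
    have h2 := psi_le hn hx'
    have h3 : y x ^ 2 / (y x ^ 2 + bb n y z x ^ 2) ≤ 1 := by
      rw [div_le_one (hr x hx')]; nlinarith [sq_nonneg (bb n y z x)]
    refine mul_nonneg (by positivity) ?_
    nlinarith
  have hOp : ∀ x, n < x → 0 < 1 / Om n x := fun x hx => one_div_pos.2 (Om_pos hn hx)
  -- sequence
  set xs : ℕ → ℝ := fun N => 3 * π / 4 + n * (π / 2) + N * (2 * π) with hxs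
  have hxsn : ∀ N, n < xs N := by
    intro N
    have : (0:ℝ) ≤ N * (2 * π) := by positivity
    simp only [hxs]
    nlinarith
  have hxsm : Monotone xs := by
    intro a b hab
    have : (a:ℝ) ≤ b := by exact_mod_cast hab
    simp only [hxs]
    gcongr
  have hxst : Tendsto xs atTop atTop := by
    have h1 : Tendsto (fun N : ℕ => (N:ℝ) * (2 * π)) atTop atTop :=
      tendsto_natCast_atTop_atTop.atTop_mul_const (by positivity)
    exact tendsto_atTop_add_const_left _ _ h1
  have hmono : Monotone fun N => ε (xs N) := fun a b hab => e1 _ _ (hxsn a) (hxsm hab)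
  have hub : ∀ x, n < x → ∀ N, ε (xs N) ≤ ε x + 1 / Om n x := by
    intro x hx N
    rcases le_total x (xs N) with h | h
    · linarith [e2 x (xs N) hx h, hOp _ (hxsn N)]
    · linarith [e1 _ _ (hxsn N) h, hOp x hx]
  have hbdd : BddAbove (Set.range fun N => ε (xs N)) :=
    ⟨ε x2 + 1 / Om n x2, by rintro _ ⟨N, rfl⟩; exact hub x2 hx2 N⟩
  obtain ⟨L, hL⟩ : ∃ L, Tendsto (fun N => ε (xs N)) atTop (𝓝 L) := ⟨_, tendsto_atTop_ciSup hmono hbdd⟩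
  have L1 : ∀ x, n < x → ε x ≤ L := by
    intro x hx
    refine ge_of_tendsto hL ?_
    filter_upwards [hxst.eventually_ge_atTop x] with N hN using e1 _ _ hx hN
  have L2 : ∀ x, n < x → L ≤ ε x + 1 / Om n x := fun x hx =>
    le_of_tendsto hL (Eventually.of_forall (hub x hx))
  have hsin : Real.sin L = 0 := by
    have t1 : Tendsto (fun N => ε (xs N) + (Om n (xs N) - (xs N - n * (π / 2)))) atTop (𝓝 L) := by
      simpa using hL.add ((Om_tendsto hn).comp hxst)
    have t2 : Tendsto (fun N => (Real.sin (ε (xs N) + (Om n (xs N) - (xs N - n * (π / 2))))) ^ 2)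
        atTop (𝓝 (Real.sin L ^ 2)) := ((Real.continuous_sin.tendsto L).comp t1).pow 2
    set e0 := EE n y z x2 * Real.exp (-(1 / Om n x2)) with he0
    have he0p : 0 < e0 := mul_pos (hE x2 hx2) (Real.exp_pos _)
    have t3 : Tendsto (fun N => (√(xs N) * y (xs N)) ^ 2 / e0) atTop (𝓝 0) := by
      have := (hseq.pow 2).div_const e0
      simpa using this
    have t4 : Tendsto (fun N => (Real.sin (ε (xs N) + (Om n (xs N) - (xs N - n * (π / 2))))) ^ 2)
        atTop (𝓝 0) := by
      refine squeeze_zero' (Eventually.of_forall fun N => sq_nonneg _) ?_ t3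
      filter_upwards [hxst.eventually_ge_atTop x2] with N hN
      have hx := hxsn N
      have hx0 := hn.trans hx
      have c1 : Real.cos (θ (xs N)) = -Real.sin (ε (xs N) + (Om n (xs N) - (xs N - n * (π / 2)))) := by
        have : θ (xs N) = ε (xs N) + (Om n (xs N) - (xs N - n * (π / 2))) + π / 2 + N * (2 * π) := by
          simp only [hε, hxs]; ring
        rw [this, Real.cos_add_nat_mul_two_pi, Real.cos_add_pi_div_two]
      have c2 : (Real.sin (ε (xs N) + (Om n (xs N) - (xs N - n * (π / 2))))) ^ 2 =
        Real.cos (θ (xs N)) ^ 2 := by rw [c1]; ring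
      rw [c2, le_div_iff₀ he0p]
      have c3 : e0 ≤ EE n y z (xs N) := by
        refine (EE_mono H hx2 hN).trans ?_
        refine mul_le_of_le_one_right (hE _ hx).le ?_
        rw [Real.exp_le_one_iff]
        linarith [hOp _ hx]
      have c4 : Real.cos (θ (xs N)) ^ 2 * EE n y z (xs N) =
          √(xs N ^ 2 - n ^ 2) * y (xs N) ^ 2 := by
        have := (hθ _ hx).2.1
        conv_rhs => rw [this]
        rw [mul_pow, Real.sq_sqrt (hr _ hx).le]
        unfold EE; ring
      have c5 : √(xs N ^ 2 - n ^ 2) ≤ xs N := by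
        rw [Real.sqrt_le_left hx0.le]; nlinarith
      calc _ ≤ Real.cos (θ (xs N)) ^ 2 * EE n y z (xs N) := by gcongr
        _ = _ := c4
        _ ≤ xs N * y (xs N) ^ 2 := by gcongr
        _ = _ := by rw [mul_pow, Real.sq_sqrt hx0.le]
    exact pow_eq_zero_iff (two_ne_zero) |>.1 (tendsto_nhds_unique t2 t4)
  have Lup : L < π := by
    have h1 := L2 x2 hx2
    have h2 : 1 / Om n x2 ≤ 1 := by rw [div_le_one (by linarith)]; exact hO2
    simp only [hε] at h1
    linarith
  have Llow : -π < L := by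
    have t1 : Tendsto (fun x => -(π / 4) - Om n x) (𝓝[>] n) (𝓝 (-(π / 4))) := by
      have := ((Om_cont hn) n Set.self_mem_Ici).mono Set.Ioi_subset_Ici_self
      have := this.tendsto.const_sub (-(π / 4))
      rwa [Om_self hn, sub_zero] at this
    have : -(π / 4) ≤ L := by
      refine le_of_tendsto t1 ?_
      filter_upwards [Ioc_mem_nhdsGT hx2] with x hx
      have h1 := hlow x hx.1 hx.2
      have h2 := L1 x hx.1
      simp only [hε] at h2
      linarith
    linarith
  have hL0 : L = 0 := (Real.sin_eq_zero_iff_of_lt_of_lt Llow Lup).1 hsin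
  refine ⟨x2, θ, hx2, hy2, cθ, fun x hx => ⟨hr x hx, (hθ x hx).2⟩, b1, b2, fun x hx => ?_⟩
  have h1 := L1 x hx
  have h2 := L2 x hx
  simp only [hε, hL0] at h1 h2
  constructor <;> linarith

lemma count_zeros {n κ x3 : ℝ} {η φ : ℝ → ℝ} (cη : ContinuousOn η (Set.Ioi n))
    (hm : ∀ a b, n < a → a < b → η a < η b) (hx3 : n < x3) (hη3 : η x3 < 0)
    (hlow : ∀ x, n < x → -(π / 2) < η x) (hφ : ∀ x, n < x → (φ x = 0 ↔ Real.sin (η x) = 0))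
    (hκ : n < κ) (hz : φ κ = 0) :
    η κ = ({t : ℝ | t ∈ Set.Ioo n κ ∧ φ t = 0}).ncard * π := by
  have hpi := Real.pi_pos
  have hint : ∀ x, n < x → φ x = 0 → ∃ j : ℕ, η x = j * π := by
    intro x hx h
    obtain ⟨j, hj⟩ := Real.sin_eq_zero_iff.1 ((hφ x hx).1 h)
    have h1 := hlow x hx
    rw [← hj] at h1
    have h2 : (-1 : ℝ) < j := by
      by_contra hc; push Not at hc
      nlinarith
    have h3 : (-1 : ℤ) < j := by exact_mod_cast h2
    refine ⟨j.toNat, ?_⟩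
    rw [← hj]
    congr 1
    have : ((j.toNat : ℤ) : ℝ) = (j : ℝ) := by rw [Int.toNat_of_nonneg (by omega)]
    rw [← this]; norm_cast
  obtain ⟨m, hmκ⟩ := hint κ hκ hz
  have h3κ : x3 ≤ κ := by
    by_contra hc; push Not at hc
    have := hm _ _ hκ hc
    have : (0:ℝ) ≤ m * π := by positivity
    linarith
  rw [hmκ]
  congr 2
  set Z := {t : ℝ | t ∈ Set.Ioo n κ ∧ φ t = 0} with hZ
  have hinj : Set.InjOn η Z := by
    intro a ha b hb e
    rcases lt_trichotomy a b with h | h | h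
    · exact absurd e (hm a b ha.1.1 h).ne
    · exact h
    · exact absurd e (hm b a hb.1.1 h).ne'
  have himg : η '' Z = (fun j : ℕ => (j:ℝ) * π) '' (Finset.range m : Set ℕ) := by
    ext v; constructor
    · rintro ⟨t, ⟨⟨h1, h2⟩, h3⟩, rfl⟩
      obtain ⟨j, hj⟩ := hint t h1 h3
      refine ⟨j, ?_, hj.symm⟩
      have := hm t κ h1 h2
      rw [hj, hmκ] at this
      have := lt_of_mul_lt_mul_right this hpi.le
      simp only [Finset.coe_range, Set.mem_Iio]
      exact_mod_cast this
    · rintro ⟨j, hj, rfl⟩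
      simp only [Finset.coe_range, Set.mem_Iio] at hj
      have hj' : (j:ℝ) < m := by exact_mod_cast hj
      have hjp : (j:ℝ) * π < m * π := mul_lt_mul_of_pos_right hj' hpi
      have hj0 : (0:ℝ) ≤ j * π := by positivity
      obtain ⟨t, ht, e⟩ := intermediate_value_Icc h3κ (cη.mono fun t ht => hx3.trans_le ht.1)
        (show (j:ℝ) * π ∈ Set.Icc (η x3) (η κ) from ⟨by linarith, by rw [hmκ]; exact hjp.le⟩)
      have htn : n < t := hx3.trans_le ht.1
      refine ⟨t, ⟨⟨htn, lt_of_le_of_ne ht.2 ?_⟩, (hφ t htn).2 ?_⟩, e⟩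
      · rintro rfl
        rw [hmκ] at e; linarith
      · rw [e]; exact Real.sin_nat_mul_pi j
  have h1 := hinj.ncard_image
  rw [himg, Set.ncard_image_of_injective _ (fun a b h => by
    have := mul_right_cancel₀ hpi.ne' h
    exact_mod_cast this), Set.ncard_coe_finset, Finset.card_range] at h1
  exact h1

theorem wkb_zero {n : ℝ} {y z : ℝ → ℝ} (H : BS n y z)
    (hseq : Tendsto (fun N : ℕ => √(3 * π / 4 + n * (π / 2) + N * (2 * π)) *
      y (3 * π / 4 + n * (π / 2) + N * (2 * π))) atTop (𝓝 0)) {σ : ℝ} (hσ : 0 < σ) {κ : ℝ}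
    (hκ : n < κ) (hz : z κ + σ * y κ = 0) (m : ℕ)
    (hm : ({t : ℝ | t ∈ Set.Ioo n κ ∧ z t + σ * y t = 0}).ncard = m) :
    |Om n κ - π * (m + 1 / 4)| ≤ (σ + 2) / Om n κ ∧ π * m - π / 4 ≤ Om n κ ∧
      Om n κ ≤ π * m + 3 * π / 4 + 1 / Om n κ := by
  have hn : 0 < n := by linarith [H.hn]
  have hpi := Real.pi_pos
  obtain ⟨x2, θ, hx2, hy2, cθ, hθ, b1, b2, hbd⟩ := wkb H hseq
  have hr : ∀ x, n < x → 0 < y x ^ 2 + (z x + σ * y x) ^ 2 := by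
    intro x hx
    by_contra hc
    have h1 : y x = 0 := by nlinarith [sq_nonneg (y x), sq_nonneg (z x + σ * y x)]
    have h2 : z x = 0 := by
      rw [h1] at hc; nlinarith [sq_nonneg (z x)]
    have := (hθ x hx).1
    simp [bb, h1, h2] at this
  have cy : ContinuousOn y (Set.Ioi n) := fun x hx => (H.hy x (hn.trans hx)).continuousAt.continuousWithinAt
  have cz : ContinuousOn z (Set.Ioi n) := fun x hx => (H.hz x (hn.trans hx)).continuousAt.continuousWithinAt
  have hne : ∀ x ∈ Set.Ioi n, x ≠ 0 := fun x hx => (hn.trans hx).ne'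
  have cz1 : ContinuousOn (fun x => z x / x) (Set.Ioi n) := cz.div continuousOn_id hne
  have cz2 : ContinuousOn (fun x => -(x ^ 2 - n ^ 2) / x * y x + σ * (z x / x)) (Set.Ioi n) := by
    have : ContinuousOn (fun x => -(x ^ 2 - n ^ 2) / x) (Set.Ioi n) :=
      ContinuousOn.div (by fun_prop) continuousOn_id hne
    fun_prop
  obtain ⟨i1, i2⟩ := init_angle (b := z x2 + σ * y x2) (hy2 x2 hx2.le le_rfl)
  obtain ⟨η, hη2, hη⟩ := prufer hx2 (g := fun x => z x + σ * y x)
    (fun x hx => H.hy x (hn.trans hx))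
    (fun x hx => (H.hz x (hn.trans hx)).add ((H.hy x (hn.trans hx)).const_mul σ))
    cz1 cz2 hr _ i1 i2
  have cη : ContinuousOn η (Set.Ioi n) := fun x hx => (hη x hx).1.continuousAt.continuousWithinAt
  have d1 : -(π / 2) < η x2 := by
    rw [hη2]; linarith [Real.arctan_lt_pi_div_two ((z x2 + σ * y x2) / y x2)]
  have d2 : η x2 < π / 2 := by
    rw [hη2]; linarith [Real.neg_pi_div_two_lt_arctan ((z x2 + σ * y x2) / y x2)]
  have hmono : ∀ a b, n < a → a < b → η a < η b := by
    intro a b ha hab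
    have : StrictMonoOn η (Set.Ioi n) := by
      refine strictMonoOn_of_deriv_pos (convex_Ioi n) cη ?_
      rw [interior_Ioi]
      intro x hx
      rw [(hη x hx).1.deriv]
      refine div_pos ?_ (hr x hx)
      have hx0 := hn.trans hx
      have hQ := Q_pos hn hx
      have e : (z x + σ * y x) * (z x / x) - y x * (-(x ^ 2 - n ^ 2) / x * y x + σ * (z x / x)) =
        (z x ^ 2 + (x ^ 2 - n ^ 2) * y x ^ 2) / x := by field_simp; ring
      rw [e]
      refine div_pos ?_ hx0
      by_contra hc
      have h1 : y x ^ 2 = 0 := by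
        have := mul_nonneg hQ.le (sq_nonneg (y x))
        have h0 : (x ^ 2 - n ^ 2) * y x ^ 2 = 0 := by nlinarith [sq_nonneg (z x)]
        exact (mul_eq_zero.1 h0).resolve_left hQ.ne'
      have h2 : z x = 0 := by nlinarith [sq_nonneg (z x)]
      have h3 : y x = 0 := by simpa using h1
      have := hr x hx
      simp [h2, h3] at this
    exact this ha (ha.trans hab) hab
  have hstrip : ∀ x, n < x → x ≤ x2 → -(π / 2) < η x := by
    intro x h1 h2
    refine stay_gt (s := Set.Icc x x2) isPreconnected_Icc
      (cη.mono fun t ht => h1.trans_le ht.1) ?_ (Set.right_mem_Icc.2 h2) (Set.left_mem_Icc.2 h2) d1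
    intro t ht e
    have := (hη t (h1.trans_le ht.1)).2.1
    rw [e, Real.cos_neg, Real.cos_pi_div_two, mul_zero] at this
    exact (hy2 t (h1.le.trans ht.1) ht.2).ne' this
  have hlow : ∀ x, n < x → -(π / 2) < η x := by
    intro x hx
    rcases le_total x x2 with h | h
    · exact hstrip x hx h
    · rcases h.eq_or_lt with h | h
      · rw [← h]; exact d1
      · exact d1.trans (hmono _ _ hx2 h)
  -- near n
  obtain ⟨x3, hx3, hx32, hφ3⟩ : ∃ x3, n < x3 ∧ x3 ≤ x2 ∧ 0 < z x3 + σ * y x3 := by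
    have hc : ContinuousAt (fun x => z x + σ * y x) n :=
      ((H.hz n hn).add ((H.hy n hn).const_mul σ)).continuousAt
    have hp : 0 < z n + σ * y n := by have := H.yn; have := H.zn; positivity
    have h1 : ∀ᶠ x in 𝓝[>] n, 0 < z x + σ * y x :=
      (hc.eventually (lt_mem_nhds hp)).filter_mono nhdsWithin_le_nhds
    obtain ⟨x, hx, hx'⟩ := (h1.and (Ioc_mem_nhdsGT hx2)).exists
    exact ⟨x, hx'.1, hx'.2, hx⟩
  have hη3 : η x3 < 0 := by
    by_contra hc; push Not at hc
    have h1 : η x3 ≤ π / 2 := by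
      rcases hx32.eq_or_lt with h | h
      · rw [h]; exact d2.le
      · exact ((hmono _ _ hx3 h).trans d2).le
    have h2 := Real.sin_nonneg_of_nonneg_of_le_pi hc (by linarith)
    have h3 := (hη x3 hx3).2.2
    have h4 := mul_nonneg (Real.sqrt_nonneg (y x3 ^ 2 + (z x3 + σ * y x3) ^ 2)) h2
    linarith
  have hφ : ∀ x, n < x → (z x + σ * y x = 0 ↔ Real.sin (η x) = 0) := by
    intro x hx
    have h3 := (hη x hx).2.2
    have h4 := Real.sqrt_pos.2 (hr x hx)
    constructor
    · intro h
      simp only [h] at h3 h4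
      have : √(y x ^ 2 + 0 ^ 2) * Real.sin (η x) = 0 := by linarith
      exact (mul_eq_zero.1 this).resolve_left h4.ne'
    · intro h
      simp only [h, mul_zero, neg_zero] at h3
      exact h3
  have hηκ := count_zeros (φ := fun x => z x + σ * y x) cη hmono hx3 hη3 hlow hφ hκ hz
  rw [hm] at hηκ
  -- link
  have hlink : ∀ x, n < x → Real.cos (η x) = -Real.cos (θ x) → Real.sin (η x) = -Real.sin (θ x) →
      False := by
    intro x hx c s
    obtain ⟨r0, r1, r2⟩ := hθ x hx
    obtain ⟨-, q1, q2⟩ := hη x hx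
    have hr1 := Real.sqrt_pos.2 r0
    have hq1 := Real.sqrt_pos.2 (hr x hx)
    have hS := Real.sqrt_pos.2 (Q_pos hn hx)
    rw [c] at q1
    rw [s] at q2
    set r := √(y x ^ 2 + bb n y z x ^ 2)
    set ρ := √(y x ^ 2 + (z x + σ * y x) ^ 2)
    have hc0 : Real.cos (θ x) = 0 := by
      have : (r + ρ) * Real.cos (θ x) = 0 := by linarith
      exact (mul_eq_zero.1 this).resolve_left (by positivity)
    have hy0 : y x = 0 := by rw [r1, hc0, mul_zero]
    have hb : bb n y z x = z x / √(x ^ 2 - n ^ 2) := by simp [bb, hy0]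
    rw [hb, div_eq_iff hS.ne'] at r2
    rw [hy0, mul_zero, add_zero] at q2
    have hs0 : Real.sin (θ x) = 0 := by
      have : (r * √(x ^ 2 - n ^ 2) + ρ) * Real.sin (θ x) = 0 := by linarith
      exact (mul_eq_zero.1 this).resolve_left (by positivity)
    have := Real.sin_sq_add_cos_sq (θ x)
    rw [hs0, hc0] at this
    norm_num at this
  have cD : ContinuousOn (fun x => η x - θ x) (Set.Ioi n) := cη.sub cθ
  have D1 : η κ - θ κ < π := by
    refine stay_lt (f := fun x => η x - θ x) (convex_Ioi n).isPreconnected cD ?_ (a := x2) hx2 hκ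
      (by linarith)
    intro x hx e
    have e' : η x = θ x + π := by linarith
    exact hlink x hx (by rw [e', Real.cos_add_pi]) (by rw [e', Real.sin_add_pi])
  have D2 : -π < η κ - θ κ := by
    refine stay_gt (f := fun x => η x - θ x) (convex_Ioi n).isPreconnected cD ?_ (a := x2) hx2 hκ
      (by linarith)
    intro x hx e
    have e' : η x = θ x - π := by linarith
    exact hlink x hx (by rw [e', Real.cos_sub_pi]) (by rw [e', Real.sin_sub_pi])
  obtain ⟨r0, r1, r2⟩ := hθ κ hκ
  obtain ⟨-, q1, q2⟩ := hη κ hκ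
  have hr1 := Real.sqrt_pos.2 r0
  have hq1 := Real.sqrt_pos.2 (hr κ hκ)
  have hS := Real.sqrt_pos.2 (Q_pos hn hκ)
  have hO := Om_pos hn hκ
  obtain ⟨B1, B2⟩ := hbd κ hκ
  set r := √(y κ ^ 2 + bb n y z κ ^ 2)
  set ρ := √(y κ ^ 2 + (z κ + σ * y κ) ^ 2)
  set δ := θ κ - m * π with hδ
  have hθδ : θ κ = δ + m * π := by rw [hδ]; ring
  have hcm : Real.cos (m * π) ^ 2 = 1 := by
    have := Real.sin_sq_add_cos_sq (m * π)
    rw [Real.sin_nat_mul_pi] at this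
    linarith
  have hcm0 : Real.cos (m * π) ≠ 0 := by
    intro h; rw [h] at hcm; norm_num at hcm
  have cθκ : Real.cos (θ κ) = Real.cos δ * Real.cos (m * π) := by
    rw [hθδ, Real.cos_add, Real.sin_nat_mul_pi]; ring
  have sθκ : Real.sin (θ κ) = Real.sin δ * Real.cos (m * π) := by
    rw [hθδ, Real.sin_add, Real.sin_nat_mul_pi]; ring
  have hcδ : 0 < Real.cos δ := by
    rw [hηκ] at q1
    rw [cθκ] at r1
    have : r * Real.cos δ = ρ := by
      have : (r * Real.cos δ) * Real.cos (m * π) ^ 2 = ρ * Real.cos (m * π) ^ 2 := by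
        linear_combination Real.cos (m * π) * (q1 - r1)
      rwa [hcm, mul_one, mul_one] at this
    rw [← this] at hq1
    exact pos_of_mul_pos_right hq1 hr1.le
  have hδ1 : δ < π / 2 := by
    by_contra hc; push Not at hc
    have := Real.cos_nonpos_of_pi_div_two_le_of_le hc (by linarith)
    linarith
  have hδ2 : -(π / 2) < δ := by
    by_contra hc; push Not at hc
    have := Real.cos_nonpos_of_pi_div_two_le_of_le (x := -δ) (by linarith) (by linarith)
    rw [Real.cos_neg] at this
    linarith
  set T := σ / √(κ ^ 2 - n ^ 2) - hh n κ with hT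
  have htan : Real.tan δ = T := by
    rw [Real.tan_eq_sin_div_cos, div_eq_iff hcδ.ne']
    have hb : bb n y z κ = -T * y κ := by
      have : z κ = -(σ * y κ) := by linarith
      rw [bb, this, hT]; ring
    rw [hb, r1] at r2
    rw [cθκ, sθκ] at r2
    have : r * Real.cos (m * π) * (Real.sin δ - T * Real.cos δ) = 0 := by linarith
    have := (mul_eq_zero.1 this).resolve_left (mul_ne_zero hr1.ne' hcm0)
    linarith
  have hTu : T ≤ σ / Om n κ := by
    have h1 := hh_nonneg hn hκ
    have h2 : σ / √(κ ^ 2 - n ^ 2) ≤ σ / Om n κ :=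
      div_le_div_of_nonneg_left hσ.le hO (Om_le_sqrt hn)
    linarith
  have hTl : -(1 / Om n κ) ≤ T := by
    have h1 := hh_le hn hκ
    have h2 : 0 ≤ σ / √(κ ^ 2 - n ^ 2) := by positivity
    linarith
  have hσO : 0 < σ / Om n κ := by positivity
  have h1O : 0 < 1 / Om n κ := by positivity
  have du : δ ≤ σ / Om n κ := by
    rcases le_total δ 0 with h | h
    · linarith
    · have := Real.le_tan h hδ1
      linarith
  have dl : -(1 / Om n κ) ≤ δ := by
    rcases le_total 0 δ with h | h
    · linarith
    · have := Real.le_tan (x := -δ) (by linarith) (by linarith)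
      rw [Real.tan_neg] at this
      linarith
  have e3 : (σ + 2) / Om n κ = σ / Om n κ + 1 / Om n κ + 1 / Om n κ := by ring
  refine ⟨?_, ?_, ?_⟩
  · rw [abs_le, e3]; constructor <;> linarith
  · linarith
  · linarith

lemma bessel_zero {n : ℕ} (hn : 8 ≤ n) {σ : ℝ} (hσ : 0 < σ) {κ : ℝ} (hκ : 0 < κ)
    (hz : phiRobin σ n κ = 0) (m : ℕ)
    (hm : ({t : ℝ | t ∈ Set.Ioo 0 κ ∧ phiRobin σ n t = 0}).ncard = m) :
    (n:ℝ) < κ ∧ |Om n κ - π * (m + 1 / 4)| ≤ (σ + 2) / Om n κ ∧ π * m - π / 4 ≤ Om n κ ∧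
      Om n κ ≤ π * m + 3 * π / 4 + 1 / Om n κ := by
  have hn8 : (8:ℝ) ≤ n := by exact_mod_cast hn
  have hn0 : (0:ℝ) < n := by linarith
  have hno : ∀ x, 0 < x → x ≤ (n:ℝ) → phiRobin σ n x ≠ 0 := by
    intro x hx hxn h
    have h1 := bJ_pos n (by omega) x hx hxn
    rw [phi_eq] at h
    have : besselJ n x * bZ n x = -(σ * besselJ n x ^ 2) := by linear_combination besselJ n x * h
    nlinarith [mul_nonneg hσ.le (sq_nonneg (besselJ n x))]
  have hnκ : (n:ℝ) < κ := by
    by_contra hc; push Not at hc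
    exact hno κ hκ hc hz
  refine ⟨hnκ, ?_⟩
  have h1 := bJ_pos n (by omega) n hn0 le_rfl
  obtain ⟨s, hs, hs1, hs2⟩ : ∃ s : ℝ, s ≠ 0 ∧ 0 < s * besselJ n n ∧ 0 < s * bZ n n := by
    rcases lt_or_ge 0 (besselJ n n) with h | h
    · exact ⟨1, by norm_num, by linarith, by rw [one_mul]; exact pos_of_mul_pos_right h1 h.le⟩
    · refine ⟨-1, by norm_num, ?_, ?_⟩
      · rcases h.eq_or_lt with h | h
        · rw [h, zero_mul] at h1; exact absurd h1 (lt_irrefl _)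
        · linarith
      · have : 0 < (-besselJ n n) * (-1 * bZ n n) := by linarith
        exact pos_of_mul_pos_right this (by linarith)
  have H : BS n (fun x => s * besselJ n x) (fun x => s * bZ n x) := by
    refine ⟨hn8, fun x hx => ?_, fun x hx => ?_, hs1, hs2⟩
    · exact ((hasDerivAt_bJz n x hx).const_mul s).congr_deriv (by ring)
    · exact ((hasDerivAt_bZ n x hx).const_mul s).congr_deriv (by ring)
  have hphi : ∀ x, s * bZ n x + σ * (s * besselJ n x) = s * phiRobin σ n x := by
    intro x; rw [phi_eq]; ring
  refine wkb_zero H ?_ hσ hnκ ?_ m ?_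
  · have := (bJ_seq n).const_mul s
    rw [mul_zero] at this
    refine this.congr fun N => by ring
  · rw [hphi, hz, mul_zero]
  · rw [← hm]
    congr 1
    ext t
    simp only [Set.mem_ofPred_eq, Set.mem_Ioo, hphi, mul_eq_zero, hs, false_or]
    constructor
    · rintro ⟨⟨a, b⟩, c⟩; exact ⟨⟨hn0.trans a, b⟩, c⟩
    · rintro ⟨⟨a, b⟩, c⟩
      refine ⟨⟨?_, b⟩, c⟩
      by_contra hc; push Not at hc
      exact hno t a hc c

lemma crude {n X : ℝ} (hn : 8 ≤ n) (hO : Om n X ≤ 3) : X - n ≤ 4 * n ^ ((1:ℝ) / 3) := by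
  have hn0 : 0 < n := by linarith
  set e := n ^ ((1:ℝ) / 3) with he
  have hep : 0 < e := by positivity
  have he3 : e ^ 3 = n := by
    rw [he, ← Real.rpow_natCast, ← Real.rpow_mul (by positivity)]; norm_num
  have hen : 4 * e ≤ n := by
    by_contra h; push Not at h
    have : n ^ 3 < (4 * e) ^ 3 := pow_lt_pow_left₀ h hn0.le (by norm_num)
    rw [mul_pow, he3] at this
    have h2 : 64 ≤ n ^ 2 := by nlinarith
    nlinarith [mul_le_mul_of_nonneg_left h2 hn0.le]
  by_contra hc
  push Not at hc
  have h1 := Om_mono hn0 (by linarith : n ≤ n + 4 * e) (by linarith : n + 4 * e ≤ X)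
  have h2 := Om_lower hn0 (by linarith : n < n + 4 * e)
  rw [add_sub_cancel_left] at h2
  have h3 : √(2 * n) * √(4 * e) = √8 * e ^ 2 := by
    rw [← Real.sqrt_mul (by positivity), ← he3, show 2 * e ^ 3 * (4 * e) = 8 * (e ^ 2) ^ 2 by ring,
      Real.sqrt_mul (by norm_num), Real.sqrt_sq (by positivity)]
  have h4 : (2:ℝ) < √8 + 1 / 2 := by
    have : (2.5:ℝ) < √8 := by rw [Real.lt_sqrt (by norm_num)]; norm_num
    linarith
  have h5 : (2.5:ℝ) < √8 := by rw [Real.lt_sqrt (by norm_num)]; norm_num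
  have h6 : 2 / 3 * √(2 * n) * (4 * e * √(4 * e)) = 8 / 3 * √8 * n := by
    rw [← he3]
    rw [← he3] at h3
    linear_combination 2 / 3 * 4 * e * h3
  rw [h6, div_le_iff₀ (by linarith)] at h2
  have h7 : Om n (n + 4 * e) * (n + 4 * e) ≤ 3 * (2 * n) := by
    apply mul_le_mul (h1.trans hO) (by linarith) (by linarith) (by norm_num)
  nlinarith

lemma p_mono {n a t : ℝ} (hn : 0 < n) (ha : n < a) (hat : a ≤ t) :
    √(a ^ 2 - n ^ 2) / a ≤ √(t ^ 2 - n ^ 2) / t := by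
  have ha0 := hn.trans ha
  have ht0 := ha0.trans_le hat
  have e : ∀ x, 0 < x → √(x ^ 2 - n ^ 2) / x = √(1 - (n / x) ^ 2) := by
    intro x hx
    rw [show 1 - (n / x) ^ 2 = (x ^ 2 - n ^ 2) / x ^ 2 by field_simp, Real.sqrt_div' _ (by positivity),
      Real.sqrt_sq hx.le]
  rw [e a ha0, e t ht0]
  gcongr

lemma mv {n a b : ℝ} (hn : 0 < n) (ha : n < a) (hab : a ≤ b) :
    √(a ^ 2 - n ^ 2) / a * (b - a) ≤ Om n b - Om n a := by
  have hd : ∀ x, n < x → HasDerivAt (fun x => Om n x - √(a ^ 2 - n ^ 2) / a * x)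
      (√(x ^ 2 - n ^ 2) / x - √(a ^ 2 - n ^ 2) / a) x := by
    intro x hx
    exact ((Om_deriv hn hx).sub ((hasDerivAt_id x).const_mul (√(a ^ 2 - n ^ 2) / a))).congr_deriv
      (by ring)
  have := le_of_deriv hab (fun x hx => (hd x (ha.trans_le hx.1)).continuousAt.continuousWithinAt)
    (fun x hx => hd x (ha.trans hx.1)) fun x hx => by
      rw [sub_nonneg]; exact p_mono hn ha hx.1.le
  linarith

lemma p_low {n a c k : ℝ} (hn : 0 < n) (ha : n < a) (hc : 0 < c) (hk : 0 < k) (hkn : k ≤ n / c)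
    (hO : k ≤ Om n a) :
    min (1 / 2) (c ^ ((1:ℝ) / 3) / 2) * (k / n) ^ ((1:ℝ) / 3) ≤ √(a ^ 2 - n ^ 2) / a := by
  have ha0 := hn.trans ha
  set u := (k / n) ^ ((1:ℝ) / 3) with hu
  have hup : 0 < u := by positivity
  have hu3 : u ^ 3 = k / n := by
    rw [hu, ← Real.rpow_natCast, ← Real.rpow_mul (by positivity)]; norm_num
  rcases le_total a (2 * n) with h | h
  · have h1 := hO.trans (Om_le_cube hn ha.le)
    have hs := Real.sqrt_nonneg (a ^ 2 - n ^ 2)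
    have hss := Real.sq_sqrt (Q_pos hn ha).le
    have h2 : n * u ≤ √(a ^ 2 - n ^ 2) := by
      refine le_of_pow_le_pow_left₀ (n := 3) (by norm_num) hs ?_
      rw [le_div_iff₀ (by positivity)] at h1
      rw [mul_pow, hu3]
      have e1 : n ^ 3 * (k / n) = k * n ^ 2 := by field_simp
      have e2 : √(a ^ 2 - n ^ 2) ^ 3 = (a ^ 2 - n ^ 2) * √(a ^ 2 - n ^ 2) := by
        rw [pow_succ, hss]
      rw [e1, e2]
      have : 0 ≤ k * n ^ 2 := by positivity
      linarith
    calc _ ≤ 1 / 2 * u := by gcongr; exact min_le_left _ _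
      _ ≤ _ := by
        rw [le_div_iff₀ ha0]
        nlinarith
  · have h1 : u ≤ 1 / c ^ ((1:ℝ) / 3) := by
      rw [hu, one_div (c ^ _), ← Real.inv_rpow hc.le]
      refine Real.rpow_le_rpow (by positivity) ?_ (by norm_num)
      rw [div_le_iff₀ hn]
      rw [div_eq_inv_mul] at hkn
      exact hkn
    have hcp : 0 < c ^ ((1:ℝ) / 3) := by positivity
    calc _ ≤ c ^ ((1:ℝ) / 3) / 2 * u := by gcongr; exact min_le_right _ _
      _ ≤ c ^ ((1:ℝ) / 3) / 2 * (1 / c ^ ((1:ℝ) / 3)) := by gcongr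
      _ = 1 / 2 := by field_simp
      _ ≤ _ := by
        rw [le_div_iff₀ ha0]
        apply Real.le_sqrt_of_sq_le
        nlinarith

lemma fine {n a b c k C : ℝ} (hn : 0 < n) (ha : n < a) (hb : n < b) (hc : 0 < c) (hk : 0 < k)
    (hkn : k ≤ n / c) (hOa : k ≤ Om n a) (hOb : k ≤ Om n b) (hab : |Om n a - Om n b| ≤ C / k) :
    |a - b| ≤ C / min (1 / 2) (c ^ ((1:ℝ) / 3) / 2) * n ^ ((1:ℝ) / 3) * k ^ (-(4:ℝ) / 3) := by
  have hcp : 0 < c ^ ((1:ℝ) / 3) := by positivity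
  have key : ∀ a b, n < a → k ≤ Om n a → a ≤ b → |Om n a - Om n b| ≤ C / k →
      |a - b| ≤ C / min (1 / 2) (c ^ ((1:ℝ) / 3) / 2) * n ^ ((1:ℝ) / 3) * k ^ (-(4:ℝ) / 3) := by
    intro a b ha hOa hle h
    rw [abs_sub_comm, abs_of_nonneg (by linarith)]
    have h1 := mv hn ha hle
    have h2 := p_low hn ha hc hk hkn hOa
    set c1 := min (1 / 2) (c ^ ((1:ℝ) / 3) / 2) with hc1
    have hc1p : 0 < c1 := lt_min (by norm_num) (by positivity)
    have h3 : Om n b - Om n a ≤ C / k := by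
      rw [abs_sub_comm] at h; exact (le_abs_self _).trans h
    have h4 : c1 * (k / n) ^ ((1:ℝ) / 3) * (b - a) ≤ C / k :=
      (mul_le_mul_of_nonneg_right h2 (by linarith)).trans (h1.trans h3)
    have e1 : (k / n) ^ ((1:ℝ) / 3) = k ^ ((1:ℝ) / 3) / n ^ ((1:ℝ) / 3) :=
      Real.div_rpow hk.le hn.le _
    have e2 : k ^ (-(4:ℝ) / 3) = 1 / (k * k ^ ((1:ℝ) / 3)) := by
      rw [show -(4:ℝ) / 3 = -(1 + 1 / 3) by norm_num, Real.rpow_neg hk.le, Real.rpow_add hk,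
        Real.rpow_one, one_div (k * _)]
    rw [e1] at h4
    rw [e2]
    have hn3 : 0 < n ^ ((1:ℝ) / 3) := by positivity
    have hk3 : 0 < k ^ ((1:ℝ) / 3) := by positivity
    set N := n ^ ((1:ℝ) / 3)
    set M := k ^ ((1:ℝ) / 3)
    have e3 : C / c1 * N * (1 / (k * M)) = C / k / (c1 * (M / N)) := by field_simp
    rw [e3, le_div_iff₀ (by positivity)]
    linarith
  rcases le_total a b with h | h
  · exact key a b ha hOa h hab
  · rw [abs_sub_comm]; rw [abs_sub_comm] at hab
    exact key b a hb hOb h hab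

/-- Fix `σ > 0` and `c > 0`. Let `F x y` be the unique `t > 0` with `t ≥ x` and
`y = t·g(x/t)`, and let `κ n k` be the `k`-th positive zero of `φ_{n,σ}`. Then there are
`K > 0` and `n₀` such that for all `n ≥ n₀` and `1 ≤ k ≤ n/c`,
`|κ_{n,k} − F(n, k − 3/4)| ≤ K n^{1/3} k^{−4/3}`. -/
theorem bessel_robin_zeros_small_k (σ c : ℝ) (hσ : 0 < σ) (hc : 0 < c)
    (F : ℝ → ℝ → ℝ)
    (hF : ∀ x y : ℝ, 0 ≤ x → 0 ≤ y → ¬(x = 0 ∧ y = 0) →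
      0 < F x y ∧ x ≤ F x y ∧ y = F x y * gfun (x / F x y))
    (κ : ℕ → ℕ → ℝ)
    (hκ : ∀ n k : ℕ, 1 ≤ k → 0 < κ n k ∧ phiRobin σ n (κ n k) = 0 ∧
      ({t : ℝ | t ∈ Set.Ioo 0 (κ n k) ∧ phiRobin σ n t = 0}).ncard = k - 1) :
    ∃ K : ℝ, 0 < K ∧ ∃ n₀ : ℕ, ∀ n : ℕ, n₀ ≤ n → ∀ k : ℕ, 1 ≤ k → (k : ℝ) ≤ (n : ℝ) / c →
      |κ n k - F (n : ℝ) ((k : ℝ) - 3/4)|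
        ≤ K * (n : ℝ) ^ ((1:ℝ)/3) * (k : ℝ) ^ (-(4:ℝ)/3) := by
  have hc1p : 0 < min (1 / 2) (c ^ ((1:ℝ) / 3) / 2) := lt_min (by norm_num) (by positivity)
  set c1 := min (1 / 2) (c ^ ((1:ℝ) / 3) / 2) with hc1
  refine ⟨4 + (σ + 2) / c1, by positivity, 8, fun n hn k hk hkn => ?_⟩
  have hn8 : (8:ℝ) ≤ n := by exact_mod_cast hn
  have hn0 : (0:ℝ) < n := by linarith
  have hk1 : (1:ℝ) ≤ k := by exact_mod_cast hk
  have hpi := Real.pi_gt_three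
  have hpi4 := Real.pi_lt_d2
  obtain ⟨h1, h2, h3⟩ := hκ n k hk
  obtain ⟨hnκ, z1, z2, z3⟩ := bessel_zero hn hσ h1 h2 (k - 1) h3
  rw [Nat.cast_sub hk, Nat.cast_one] at z1 z2 z3
  obtain ⟨f1, f2, f3⟩ := hF n (k - 3 / 4) hn0.le (by linarith) (fun h => by linarith [h.1])
  set f := F (n:ℝ) ((k:ℝ) - 3 / 4) with hf
  have fO : Om n f = π * (k - 3 / 4) := by rw [← gfun_Om hn0.le f1, ← f3]
  have hfn : (n:ℝ) < f := by
    refine lt_of_le_of_ne f2 fun h => ?_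
    rw [← h, Om_self hn0] at fO
    nlinarith
  have hN : 0 < (n:ℝ) ^ ((1:ℝ) / 3) := by positivity
  have hK3 : 0 < (k:ℝ) ^ (-(4:ℝ) / 3) := by positivity
  rcases hk.eq_or_lt with h | h
  · have hk' : (k:ℝ) = 1 := by rw [← h]; norm_num
    rw [hk'] at z3 fO ⊢
    have g1 : Om n f ≤ 3 := by rw [fO]; linarith
    have g2 : Om n (κ n k) ≤ 3 := by
      by_contra hcon; push Not at hcon
      have : 1 / Om n (κ n k) ≤ 1 / 3 := by gcongr
      norm_num at z3 hpi4
      rw [one_div] at this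
      linarith
    have a1 := crude hn8 g1
    have a2 := crude hn8 g2
    rw [Real.one_rpow, mul_one]
    have a3 : 0 < (σ + 2) / c1 * (n:ℝ) ^ ((1:ℝ) / 3) := by positivity
    rw [abs_le]; constructor <;> linarith
  · have hk2 : (2:ℝ) ≤ k := by exact_mod_cast h
    have g1 : (k:ℝ) ≤ Om n f := by rw [fO]; nlinarith
    have g2 : (k:ℝ) ≤ Om n (κ n k) := by
      refine le_trans ?_ z2
      nlinarith
    have hO := Om_pos hn0 hnκ
    have g3 : |Om n (κ n k) - Om n f| ≤ (σ + 2) / k := by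
      rw [fO, show (k:ℝ) - 3 / 4 = k - 1 + 1 / 4 by ring]
      refine z1.trans ?_
      gcongr
    refine (fine hn0 hnκ hfn hc (by linarith) hkn g2 g1 g3).trans ?_
    rw [← hc1]
    gcongr
    linarith
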